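/- For every real ε > 0 there exist a constant K > 0 and thresholds d₀, Δ₀ such that the following holds: for every integer d ≥ d₀ and integer q, every finite simple graph G with ⌈((d+1)(q−1)+1)(1+ε)⌉ vertices and maximal degree Δ ≥ Δ₀ satisfying q > K·Δ, and every continuous map f from the geometric simplex Δ_{V(G)} to ℝ^d, there is a q-coloring C_1 ∪ C_2 ∪ … ∪ C_q = V(G) of G such that the intersection over i = 1,…,q of the images f(face spanned by C_i) is non-empty. -/

import Mathlib

namespace ListChain

section Basic

variable (F : Type*) [Field F] {α β : Type*}

/-- Prefixing a vertex to every list of a chain. -/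
noncomputable def prepend (x : α) : (List α →₀ F) →ₗ[F] (List α →₀ F) :=
  Finsupp.lmapDomain F F (List.cons x)

/-- The alternating sum of the lists obtained by deleting one entry. -/
noncomputable def bdryList : List α → (List α →₀ F)
  | [] => 0
  | x :: l => Finsupp.single l 1 - prepend F x (bdryList l)

/-- The augmented boundary operator on chains of lists. -/
noncomputable def bdry : (List α →₀ F) →ₗ[F] (List α →₀ F) :=
  Finsupp.linearCombination F (bdryList F)

/-- The chain map induced by a map of vertices. -/
noncomputable def push (g : α → β) : (List α →₀ F) →ₗ[F] (List β →₀ F) :=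
  Finsupp.lmapDomain F F (List.map g)

/-- The prism operator between the chain maps of `g` and `h`. -/
noncomputable def prismList (g h : α → β) : List α → (List β →₀ F)
  | [] => 0
  | x :: l => Finsupp.single (g x :: h x :: l.map h) 1 - prepend F (g x) (prismList g h l)

noncomputable def prism (g h : α → β) : (List α →₀ F) →ₗ[F] (List β →₀ F) :=
  Finsupp.linearCombination F (prismList F g h)

/-- Chains supported on lists of length `j` with entries in `P` that are pairwise related by `r`. -/
noncomputable def chains (r : α → α → Prop) (P : Set α) (j : ℕ) : Submodule F (List α →₀ F) :=
  Finsupp.supported F F {l | l.length = j ∧ l.Pairwise r ∧ ∀ x ∈ l, x ∈ P}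

variable {F}

@[simp] lemma prepend_single (x : α) (l : List α) (a : F) :
    prepend F x (Finsupp.single l a) = Finsupp.single (x :: l) a := by
  simp [prepend]

@[simp] lemma push_single (g : α → β) (l : List α) (a : F) :
    push F g (Finsupp.single l a) = Finsupp.single (l.map g) a := by
  simp [push]

lemma bdry_single (l : List α) : bdry F (Finsupp.single l 1) = bdryList F l := by
  simp [bdry]

lemma prism_single (g h : α → β) (l : List α) :
    prism F g h (Finsupp.single l 1) = prismList F g h l := by
  simp [prism]

lemma bdry_single_nil : bdry F (Finsupp.single ([] : List α) 1) = 0 := by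
  simp [bdry, bdryList]

lemma linearMap_ext_single {M : Type*} [AddCommGroup M] [Module F M]
    {φ ψ : (List α →₀ F) →ₗ[F] M}
    (h : ∀ l, φ (Finsupp.single l 1) = ψ (Finsupp.single l 1)) : φ = ψ := by
  ext l
  simpa using h l

lemma bdry_prepend (x : α) (c : List α →₀ F) :
    bdry F (prepend F x c) = c - prepend F x (bdry F c) := by
  have : bdry F ∘ₗ prepend F x = LinearMap.id - prepend F x ∘ₗ bdry F := by
    refine linearMap_ext_single fun l ↦ ?_
    simp [bdry_single, bdryList]
  exact LinearMap.congr_fun this c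

lemma bdry_bdryList (l : List α) : bdry F (bdryList F l) = 0 := by
  induction l with
  | nil => simp [bdryList]
  | cons x l ih => simp [bdryList, bdry_prepend, bdry_single, ih]

lemma bdry_bdry (c : List α →₀ F) : bdry F (bdry F c) = 0 := by
  have : bdry F ∘ₗ bdry F = (0 : (List α →₀ F) →ₗ[F] (List α →₀ F)) := by
    refine linearMap_ext_single fun l ↦ ?_
    simp [bdry_single, bdry_bdryList]
  exact LinearMap.congr_fun this c

lemma push_prepend (g : α → β) (x : α) (c : List α →₀ F) :
    push F g (prepend F x c) = prepend F (g x) (push F g c) := by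
  have : push F g ∘ₗ prepend F x = prepend F (g x) ∘ₗ push F g :=
    linearMap_ext_single fun l ↦ by simp
  exact LinearMap.congr_fun this c

lemma push_bdryList (g : α → β) (l : List α) :
    push F g (bdryList F l) = bdryList F (l.map g) := by
  induction l with
  | nil => simp [bdryList]
  | cons x l ih => simp [bdryList, push_prepend, ih]

lemma bdry_push (g : α → β) (c : List α →₀ F) :
    bdry F (push F g c) = push F g (bdry F c) := by
  have : bdry F ∘ₗ push F g = push F g ∘ₗ bdry F :=
    linearMap_ext_single fun l ↦ by simp [bdry_single, push_bdryList]
  exact LinearMap.congr_fun this c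

lemma bdry_prismList (g h : α → β) (l : List α) :
    bdry F (prismList F g h l) + prism F g h (bdryList F l)
      = Finsupp.single (l.map h) 1 - Finsupp.single (l.map g) 1 := by
  have key (x : α) (c : List α →₀ F) : prism F g h (prepend F x c)
      = prepend F (g x) (prepend F (h x) (push F h c)) - prepend F (g x) (prism F g h c) := by
    have : prism F g h ∘ₗ prepend F x = prepend F (g x) ∘ₗ prepend F (h x) ∘ₗ push F h
        - prepend F (g x) ∘ₗ prism F g h :=
      linearMap_ext_single fun l ↦ by simp [prism_single, prismList]
    exact LinearMap.congr_fun this c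
  induction l with
  | nil => simp [bdryList, prismList]
  | cons x l ih =>
    have ih' := congrArg (prepend F (g x)) (eq_sub_of_add_eq ih)
    simp only [map_sub, prepend_single] at ih'
    simp only [bdryList, prismList, map_sub, bdry_single, bdry_prepend, key, ih', prism_single,
      push_bdryList, List.map_cons, prepend_single]
    abel

lemma bdry_prism (g h : α → β) (c : List α →₀ F) :
    bdry F (prism F g h c) + prism F g h (bdry F c) = push F h c - push F g c := by
  have : bdry F ∘ₗ prism F g h + prism F g h ∘ₗ bdry F = push F h - push F g :=
    linearMap_ext_single fun l ↦ by
      simp [bdry_single, prism_single, bdry_prismList]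
  exact LinearMap.congr_fun this c

variable {r : α → α → Prop} {s : β → β → Prop} {P : Set α} {P' : Set β}

lemma single_mem_chains {l : List α} {j : ℕ} (hj : l.length = j) (hl : l.Pairwise r)
    (hP : ∀ x ∈ l, x ∈ P) : Finsupp.single l (1 : F) ∈ chains F r P j :=
  Finsupp.single_mem_supported _ _ ⟨hj, hl, hP⟩

/-- To map chains into a submodule it suffices to map the basis lists. -/
lemma map_chains_le {M : Type*} [AddCommGroup M] [Module F M]
    {φ : (List α →₀ F) →ₗ[F] M} {N : Submodule F M} {j : ℕ}
    (h : ∀ l : List α, l.length = j → l.Pairwise r → (∀ x ∈ l, x ∈ P) →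
      φ (Finsupp.single l 1) ∈ N) {c : List α →₀ F} (hc : c ∈ chains F r P j) : φ c ∈ N := by
  rw [chains, Finsupp.supported_eq_span_single] at hc
  have : Submodule.span F ((fun l : List α ↦ Finsupp.single l (1 : F)) ''
      {l | l.length = j ∧ l.Pairwise r ∧ ∀ x ∈ l, x ∈ P}) ≤ N.comap φ := by
    rw [Submodule.span_le]
    rintro _ ⟨l, ⟨h1, h2, h3⟩, rfl⟩
    exact h l h1 h2 h3
  exact this hc

lemma chains_congr {M : Type*} [AddCommGroup M] [Module F M]
    {φ ψ : (List α →₀ F) →ₗ[F] M} {j : ℕ}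
    (h : ∀ l : List α, l.length = j → l.Pairwise r → (∀ x ∈ l, x ∈ P) →
      φ (Finsupp.single l 1) = ψ (Finsupp.single l 1))
    {c : List α →₀ F} (hc : c ∈ chains F r P j) : φ c = ψ c := by
  have := map_chains_le (φ := φ - ψ) (N := ⊥) (fun l h1 h2 h3 ↦ by
    simp [h l h1 h2 h3]) hc
  simpa [sub_eq_zero] using this

lemma prepend_mem_chains {x : α} {j : ℕ} (hx : x ∈ P) {c : List α →₀ F}
    (hc : c ∈ chains F r {y | y ∈ P ∧ r x y} j) : prepend F x c ∈ chains F r P (j + 1) := by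
  refine map_chains_le (fun l h1 h2 h3 ↦ ?_) hc
  rw [prepend_single]
  refine single_mem_chains (by simp [h1]) (List.pairwise_cons.2 ⟨fun y hy ↦ (h3 y hy).2, h2⟩) ?_
  rintro y hy
  rcases List.mem_cons.1 hy with rfl | hy
  · exact hx
  · exact (h3 y hy).1

lemma chains_mono {Q : Set α} (h : P ⊆ Q) (j : ℕ) : chains F r P j ≤ chains F r Q j :=
  Finsupp.supported_mono fun _ hl ↦ ⟨hl.1, hl.2.1, fun x hx ↦ h (hl.2.2 x hx)⟩

lemma bdryList_mem_chains (l : List α) : ∀ P : Set α, l.Pairwise r → (∀ x ∈ l, x ∈ P) →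
    bdryList F l ∈ chains F r P (l.length - 1) := by
  induction l with
  | nil => intro P _ _; simp [bdryList]
  | cons x l ih =>
    intro P hl hP
    rw [List.pairwise_cons] at hl
    have hP' : ∀ y ∈ l, y ∈ P := fun y hy ↦ hP y (List.mem_cons_of_mem _ hy)
    refine Submodule.sub_mem _ (single_mem_chains (by simp) hl.2 hP') ?_
    have := ih {y | y ∈ P ∧ r x y} hl.2 fun y hy ↦ ⟨hP' y hy, hl.1 y hy⟩
    rcases l with _ | ⟨y, l⟩
    · simp [bdryList]
    · simpa using prepend_mem_chains (hP x (by simp)) this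

lemma bdry_mem_chains {j : ℕ} {c : List α →₀ F} (hc : c ∈ chains F r P j) :
    bdry F c ∈ chains F r P (j - 1) := by
  refine map_chains_le (fun l h1 h2 h3 ↦ ?_) hc
  rw [bdry_single, ← h1]
  exact bdryList_mem_chains l P h2 h3

lemma push_mem_chains {g : α → β} {j : ℕ} (hg : ∀ x ∈ P, g x ∈ P')
    (hr : ∀ x ∈ P, ∀ y ∈ P, r x y → s (g x) (g y))
    {c : List α →₀ F} (hc : c ∈ chains F r P j) : push F g c ∈ chains F s P' j := by
  refine map_chains_le (fun l h1 h2 h3 ↦ ?_) hc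
  rw [push_single]
  refine single_mem_chains (by simp [h1]) ?_ (by simpa using fun x hx ↦ hg x (h3 x hx))
  rw [List.pairwise_map]
  exact h2.imp_of_mem fun hx hy h ↦ hr _ (h3 _ hx) _ (h3 _ hy) h

lemma prismList_mem_chains {g h : α → β}
    (hr : ∀ x y, r x y → s (g x) (g y) ∧ s (g x) (h y) ∧ s (h x) (h y))
    (hgh : ∀ x, s (g x) (h x)) (l : List α) : ∀ P' : Set β, l.Pairwise r →
    (∀ x ∈ l, g x ∈ P' ∧ h x ∈ P') →
    prismList F g h l ∈ chains F s P' (l.length + 1) := by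
  induction l with
  | nil => intro P' _ _; simp [prismList]
  | cons x l ih =>
    intro P' hl hP'
    rw [List.pairwise_cons] at hl
    have hl' : ∀ y ∈ l, g y ∈ P' ∧ h y ∈ P' := fun y hy ↦ hP' y (List.mem_cons_of_mem _ hy)
    refine Submodule.sub_mem _ (single_mem_chains (by simp) ?_ ?_) ?_
    · simp only [List.pairwise_cons, List.mem_cons, List.mem_map, List.pairwise_map]
      refine ⟨?_, ?_, hl.2.imp fun {a b} hab ↦ (hr _ _ hab).2.2⟩
      · rintro _ (rfl | ⟨y, hy, rfl⟩)
        · exact hgh x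
        · exact (hr _ _ (hl.1 y hy)).2.1
      · rintro _ ⟨y, hy, rfl⟩
        exact (hr _ _ (hl.1 y hy)).2.2
    · simp only [List.mem_cons, List.mem_map]
      rintro _ (rfl | rfl | ⟨y, hy, rfl⟩)
      · exact (hP' x (by simp)).1
      · exact (hP' x (by simp)).2
      · exact (hl' y hy).2
    · refine prepend_mem_chains (hP' x (by simp)).1 (ih {z | z ∈ P' ∧ s (g x) z} hl.2 ?_)
      exact fun y hy ↦ ⟨⟨(hl' y hy).1, (hr _ _ (hl.1 y hy)).1⟩,
        ⟨(hl' y hy).2, (hr _ _ (hl.1 y hy)).2.1⟩⟩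

/-- Chain maps of comparable order homomorphisms agree up to a boundary. -/
lemma push_sub_push_eq_bdry [Preorder α] [Preorder β] {g h : α →o β} (hgh : h ≤ g)
    (hg : ∀ x ∈ P, g x ∈ P') (hh : ∀ x ∈ P, h x ∈ P') {j : ℕ} {c : List α →₀ F}
    (hc : c ∈ chains F (· ≥ ·) P j) (hz : bdry F c = 0) :
    ∃ b ∈ chains F (· ≥ ·) P' (j + 1), bdry F b = push F h c - push F g c := by
  refine ⟨prism F g h c, map_chains_le (fun l h1 h2 h3 ↦ ?_) hc, ?_⟩
  · rw [prism_single, ← h1]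
    exact prismList_mem_chains (r := (· ≥ ·)) (s := (· ≥ ·))
      (fun x y hxy ↦ ⟨g.mono hxy, (hgh y).trans (g.mono hxy), h.mono hxy⟩) (fun x ↦ hgh x) l P' h2
      fun x hx ↦ ⟨hg x (h3 x hx), hh x (h3 x hx)⟩
  · have := bdry_prism (g : α → β) h c
    rwa [hz, map_zero, add_zero] at this

end Basic

section Acyclic

variable (F : Type*) [Field F] {α : Type*} [Preorder α]

/-- Every cycle of lists of length less than `a` in the order complex of `P` is a boundary. -/
def Acyclic (P : Set α) (a : ℕ) : Prop :=
  ∀ j < a, ∀ c ∈ chains F (· ≥ ·) P j, bdry F c = 0 →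
    ∃ b ∈ chains F (· ≥ ·) P (j + 1), bdry F b = c

variable {F}

lemma Acyclic.mono {P : Set α} {a b : ℕ} (h : Acyclic F P b) (hab : a ≤ b) : Acyclic F P a :=
  fun j hj ↦ h j (hj.trans_le hab)

omit [Preorder α] in
lemma mem_chains_zero {r : α → α → Prop} {c : List α →₀ F} {P Q : Set α}
    (hc : c ∈ chains F r P 0) : c ∈ chains F r Q 0 := by
  rw [chains, Finsupp.mem_supported] at hc ⊢
  intro l hl
  obtain ⟨h1, h2, -⟩ := hc hl
  obtain rfl := List.length_eq_zero_iff.1 h1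
  exact ⟨h1, h2, by simp⟩

lemma chains_union_le {P Q : Set α} (hP : ∀ x ∈ Q, ∀ y ∈ P, x ≤ y → x ∈ P)
    (hQ : ∀ x ∈ P, ∀ y ∈ Q, x ≤ y → x ∈ Q) (j : ℕ) :
    chains F (· ≥ ·) (P ∪ Q) j ≤ chains F (· ≥ ·) P j ⊔ chains F (· ≥ ·) Q j := by
  rw [chains, chains, chains, ← Finsupp.supported_union]
  refine Finsupp.supported_mono ?_
  rintro l ⟨h1, h2, h3⟩
  rcases l with _ | ⟨x, l⟩
  · exact Or.inl ⟨h1, h2, by simp⟩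
  · have hx : ∀ y ∈ x :: l, y ≤ x := by
      intro y hy
      rcases List.mem_cons.1 hy with rfl | hy
      · exact le_rfl
      · exact (List.pairwise_cons.1 h2).1 y hy
    rcases h3 x (by simp) with h | h
    · refine Or.inl ⟨h1, h2, fun y hy ↦ ?_⟩
      rcases h3 y hy with hmem | hmem
      · exact hmem
      · exact hP y hmem x h (hx y hy)
    · refine Or.inr ⟨h1, h2, fun y hy ↦ ?_⟩
      rcases h3 y hy with hmem | hmem
      · exact hQ y hmem x h (hx y hy)
      · exact hmem

/-- Mayer–Vietoris for order complexes of relative lower sets. -/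
lemma Acyclic.union {P Q : Set α} (hP : ∀ x ∈ Q, ∀ y ∈ P, x ≤ y → x ∈ P)
    (hQ : ∀ x ∈ P, ∀ y ∈ Q, x ≤ y → x ∈ Q) {a : ℕ} (h1 : Acyclic F P a) (h2 : Acyclic F Q a)
    (h12 : Acyclic F (P ∩ Q) (a - 1)) : Acyclic F (P ∪ Q) a := by
  intro j hj c hc hz
  rcases j with _ | j
  · obtain ⟨b, hb, hbc⟩ := h1 0 hj c (mem_chains_zero hc) hz
    exact ⟨b, chains_mono Set.subset_union_left _ hb, hbc⟩
  obtain ⟨u, hu, w, hw, rfl⟩ := Submodule.mem_sup.1 (chains_union_le hP hQ _ hc)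
  rw [map_add] at hz
  have hdu := bdry_mem_chains hu
  have hdw := bdry_mem_chains hw
  rw [add_tsub_cancel_right] at hdu hdw
  rw [eq_neg_of_add_eq_zero_right hz, Submodule.neg_mem_iff] at hdw
  have hd : bdry F u ∈ chains F (· ≥ ·) (P ∩ Q) j := by
    rw [chains, Finsupp.mem_supported] at hdu hdw ⊢
    exact fun l hl ↦ ⟨(hdu hl).1, (hdu hl).2.1, fun x hx ↦ ⟨(hdu hl).2.2 x hx, (hdw hl).2.2 x hx⟩⟩
  obtain ⟨y, hy, hyu⟩ := h12 j (by omega) _ hd (bdry_bdry u)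
  obtain ⟨b, hb, hbu⟩ := h1 _ hj (u - y)
    (Submodule.sub_mem _ hu (chains_mono Set.inter_subset_left _ hy)) (by simp [hyu])
  obtain ⟨b', hb', hbw⟩ := h2 _ hj (w + y)
    (Submodule.add_mem _ hw (chains_mono Set.inter_subset_right _ hy))
    (by rw [map_add, hyu, add_comm]; exact hz)
  refine ⟨b + b', Submodule.add_mem _ (chains_mono Set.subset_union_left _ hb)
    (chains_mono Set.subset_union_right _ hb'), ?_⟩
  rw [map_add, hbu, hbw]
  abel

end Acyclic

section Strict

variable {F : Type*} [Field F] {α : Type*} [PartialOrder α]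

open Classical in
/-- The projection that kills all lists that are not strictly decreasing. -/
noncomputable def strictPart : (List α →₀ F) →ₗ[F] (List α →₀ F) :=
  Finsupp.linearCombination F fun l ↦ if l.Pairwise (· > ·) then Finsupp.single l 1 else 0

open Classical in
lemma strictPart_single (l : List α) : strictPart (Finsupp.single l (1 : F))
    = if l.Pairwise (· > ·) then Finsupp.single l 1 else 0 := by
  simp [strictPart]

lemma strictPart_prepend (x : α) (c : List α →₀ F) :
    strictPart (prepend F x c) = strictPart (prepend F x (strictPart c)) := by
  have : strictPart ∘ₗ prepend F x = strictPart ∘ₗ prepend F x ∘ₗ strictPart := by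
    refine linearMap_ext_single fun l ↦ ?_
    by_cases h : l.Pairwise (· > ·) <;> simp [strictPart_single, h]
  exact LinearMap.congr_fun this c

lemma strictPart_of_mem {P : Set α} {j : ℕ} {c : List α →₀ F} (hc : c ∈ chains F (· > ·) P j) :
    strictPart c = c :=
  chains_congr (ψ := LinearMap.id) (fun l _ h2 _ ↦ by simp [strictPart_single, h2]) hc

lemma strictPart_mem {P : Set α} {j : ℕ} {c : List α →₀ F} (hc : c ∈ chains F (· ≥ ·) P j) :
    strictPart c ∈ chains F (· > ·) P j := by
  refine map_chains_le (fun l h1 h2 h3 ↦ ?_) hc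
  rw [strictPart_single]
  split_ifs with h
  · exact single_mem_chains h1 h h3
  · exact Submodule.zero_mem _

lemma strictPart_bdryList (l : List α) (hl : l.Pairwise (· ≥ ·))
    (hs : ¬ l.Pairwise (· > ·)) : strictPart (bdryList F l) = 0 := by
  induction l with
  | nil => simp at hs
  | cons x l ih =>
    rcases l with _ | ⟨y, l⟩
    · simp at hs
    rw [List.pairwise_cons] at hl
    rcases (hl.1 y (by simp)).lt_or_eq with hxy | rfl
    · have hs' : ¬ (y :: l).Pairwise (· > ·) := by
        refine fun h ↦ hs (List.pairwise_cons.2 ⟨fun z hz ↦ ?_, h⟩)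
        rcases List.mem_cons.1 hz with rfl | hz
        · exact hxy
        · exact ((List.pairwise_cons.1 h).1 z hz).trans hxy
      rw [bdryList, map_sub, strictPart_single, if_neg hs', strictPart_prepend, ih hl.2 hs']
      simp
    · have key (c : List α →₀ F) : strictPart (prepend F y (prepend F y c)) = 0 := by
        have : strictPart ∘ₗ prepend F y ∘ₗ prepend F y
            = (0 : (List α →₀ F) →ₗ[F] (List α →₀ F)) :=
          linearMap_ext_single fun l ↦ by simp [strictPart_single]
        exact LinearMap.congr_fun this c
      rw [bdryList, bdryList]
      simp [key]

lemma strictPart_bdry {P : Set α} {j : ℕ} {c : List α →₀ F} (hc : c ∈ chains F (· ≥ ·) P j) :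
    strictPart (bdry F c) = bdry F (strictPart c) := by
  refine chains_congr (φ := strictPart ∘ₗ bdry F) (ψ := bdry F ∘ₗ strictPart)
    (fun l h1 h2 h3 ↦ ?_) hc
  simp only [LinearMap.comp_apply, bdry_single, strictPart_single]
  split_ifs with h
  · rw [bdry_single]
    exact strictPart_of_mem (bdryList_mem_chains l P h h3)
  · rw [map_zero, strictPart_bdryList l h2 h]

end Strict

section Cyclic

variable {p : ℕ}

/-- `push` of a self-map, as an endomorphism. -/
noncomputable def pushEnd (F : Type*) [Field F] {α : Type*} (g : α → α) :
    Module.End F (List α →₀ F) :=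
  push F g

lemma pushEnd_apply {F : Type*} [Field F] {α : Type*} (g : α → α) (c : List α →₀ F) :
    pushEnd F g c = push F g c := rfl

lemma pushEnd_pow {F : Type*} [Field F] {α : Type*} (g : α → α) (i : ℕ) :
    pushEnd F g ^ i = pushEnd F g^[i] := by
  induction i with
  | zero => exact linearMap_ext_single fun l ↦ by simp [pushEnd_apply]
  | succ i ih =>
    rw [pow_succ', ih]
    exact linearMap_ext_single fun l ↦ by
      simp only [Module.End.mul_apply, pushEnd_apply, push_single, Function.iterate_succ',
        List.map_map]

/-- The maps of the periodic resolution of the cyclic group generated by `t` of order `p`. -/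
def periodic {R : Type*} [Ring R] (p : ℕ) (t : R) (j : ℕ) : R :=
  if Even j then t - 1 else ∑ i ∈ Finset.range p, t ^ i

lemma periodic_mul {R : Type*} [Ring R] {t : R} (ht : t ^ p = 1) (j : ℕ) :
    periodic p t (j + 1) * periodic p t j = 0 := by
  by_cases h : Even j
  · simp [periodic, h, Nat.even_add_one, geom_sum_mul, ht]
  · simp [periodic, h, Nat.even_add_one, mul_geom_sum, ht]

lemma periodic_add_two {R : Type*} [Ring R] (t : R) (j : ℕ) :
    periodic p t (j + 2) = periodic p t j := by
  simp [periodic, Nat.even_add_one]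

lemma periodic_comm {F M M' : Type*} [Field F] [AddCommGroup M] [Module F M] [AddCommGroup M']
    [Module F M'] {t : Module.End F M} {t' : Module.End F M'} {φ : M →ₗ[F] M'}
    (h : ∀ x, φ (t x) = t' (φ x)) (j : ℕ) (x : M) :
    φ (periodic p t j x) = periodic p t' j (φ x) := by
  have hpow (i : ℕ) : φ ((t ^ i) x) = (t' ^ i) (φ x) := by
    induction i with
    | zero => simp
    | succ i ih => rw [pow_succ', pow_succ', Module.End.mul_apply, h, ih, Module.End.mul_apply]
  by_cases hj : Even j
  · simp [periodic, hj, h]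
  · simp [periodic, hj, LinearMap.sum_apply, hpow]

lemma periodic_mem {F M : Type*} [Field F] [AddCommGroup M] [Module F M]
    {t : Module.End F M} {N : Submodule F M} (h : ∀ x ∈ N, t x ∈ N) (j : ℕ) {x : M} (hx : x ∈ N) :
    periodic p t j x ∈ N := by
  have hpow (i : ℕ) : (t ^ i) x ∈ N := by
    induction i with
    | zero => simpa
    | succ i ih => rw [pow_succ', Module.End.mul_apply]; exact h _ ih
  by_cases hj : Even j
  · simpa [periodic, hj] using N.sub_mem (h x hx) hx
  · simpa [periodic, hj, LinearMap.sum_apply] using N.sum_mem fun i _ ↦ hpow i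

lemma bdry_periodic_pushEnd {F : Type*} [Field F] {α : Type*} (g : α → α) (j : ℕ)
    (x : List α →₀ F) :
    bdry F (periodic p (pushEnd F g) j x) = periodic p (pushEnd F g) j (bdry F x) := by
  apply periodic_comm
  intro x
  rw [pushEnd_apply, pushEnd_apply, bdry_push]

lemma periodic_pushEnd_mem_chains {F : Type*} [Field F] {α : Type*} {r : α → α → Prop} {P : Set α}
    {g : α → α} (hg : ∀ x ∈ P, g x ∈ P) (hr : ∀ x y, r x y → r (g x) (g y)) {j : ℕ} (k : ℕ)
    {c : List α →₀ F} (hc : c ∈ chains F r P j) :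
    periodic p (pushEnd F g) k c ∈ chains F r P j := by
  refine periodic_mem (N := chains F r P j) (fun x hx ↦ ?_) k hc
  rw [pushEnd_apply]
  exact push_mem_chains (r := r) (s := r) hg (fun x _ y _ ↦ hr x y) hx

/-- In an acyclic complex with a cyclic symmetry there is a chain of the periodic resolution. -/
lemma exists_periodic_chain {F : Type*} [Field F] {α : Type*} [Preorder α] {P : Set α} {n : ℕ}
    (hP : Acyclic F P (n + 1)) (g : α →o α) (hg : ∀ x ∈ P, g x ∈ P) (hgp : g^[p] = id) :
    ∃ c : ℕ → (List α →₀ F), bdry F (c 0) = Finsupp.single [] 1 ∧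
      (∀ j ≤ n, c j ∈ chains F (· ≥ ·) P (j + 1)) ∧
      ∀ j < n, bdry F (c (j + 1)) = periodic p (pushEnd F g) j (c j) := by
  have hmem (j i : ℕ) {x} (hx : x ∈ chains F (· ≥ ·) P j) :
      periodic p (pushEnd F g) i x ∈ chains F (· ≥ ·) P j :=
    periodic_pushEnd_mem_chains (r := (· ≥ ·)) hg (fun _ _ h ↦ g.mono h) i hx
  have hcomm (i : ℕ) (x : List α →₀ F) :
      bdry F (periodic p (pushEnd F g) i x) = periodic p (pushEnd F g) i (bdry F x) :=
    bdry_periodic_pushEnd g i x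
  have hpow : pushEnd F g ^ p = 1 := by
    rw [pushEnd_pow, hgp]
    exact linearMap_ext_single fun l ↦ by simp [pushEnd_apply]
  suffices H : ∀ k ≤ n, ∃ c : ℕ → (List α →₀ F), bdry F (c 0) = Finsupp.single [] 1 ∧
      (∀ j ≤ k, c j ∈ chains F (· ≥ ·) P (j + 1)) ∧
      ∀ j < k, bdry F (c (j + 1)) = periodic p (pushEnd F g) j (c j) from H n le_rfl
  intro k hk
  induction k with
  | zero =>
    obtain ⟨b, hb, hb'⟩ := hP 0 (by omega) (Finsupp.single [] 1)
      (single_mem_chains rfl (by simp) (by simp)) bdry_single_nil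
    exact ⟨fun _ ↦ b, hb', fun j hj ↦ by rwa [Nat.le_zero.1 hj], by simp⟩
  | succ k ih =>
    obtain ⟨c, h0, h1, h2⟩ := ih (by omega)
    obtain ⟨b, hb, hb'⟩ := hP (k + 1) (by omega)
      (periodic p (pushEnd F g) k (c k)) (hmem _ _ (h1 k le_rfl)) (by
        rw [hcomm]
        rcases k with _ | k
        · simp [periodic, h0, pushEnd_apply]
        · rw [h2 k (by omega), ← Module.End.mul_apply, periodic_mul hpow, LinearMap.zero_apply])
    refine ⟨Function.update c (k + 1) b, ?_, fun j hj ↦ ?_, fun j hj ↦ ?_⟩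
    · rwa [Function.update_of_ne (by omega)]
    · rcases hj.lt_or_eq with hj | rfl
      · rw [Function.update_of_ne (by omega)]
        exact h1 j (by omega)
      · simpa using hb
    · rcases (Nat.lt_succ_iff.1 hj).lt_or_eq with hj | rfl
      · rw [Function.update_of_ne (by omega), Function.update_of_ne (by omega)]
        exact h2 j hj
      · rw [Function.update_self, Function.update_of_ne (by omega)]
        exact hb'

section Free

variable {F : Type*} [Field F] {β : Type*}

/-- The part of a chain whose lists have a head of colour `a`. -/
noncomputable def headPart (r : β → ZMod p) (a : ZMod p) :
    (List β →₀ F) →ₗ[F] (List β →₀ F) :=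
  Finsupp.linearCombination F fun l ↦ match l with
    | [] => 0
    | x :: l => if r x = a then Finsupp.single (x :: l) 1 else 0

lemma headPart_single (r : β → ZMod p) (a : ZMod p) (x : β) (l : List β) :
    headPart r a (Finsupp.single (x :: l) (1 : F))
      = if r x = a then Finsupp.single (x :: l) 1 else 0 := by
  simp [headPart]

variable {r : β → ZMod p} {s : β → β → Prop} {D : Set β} {j : ℕ} {c : List β →₀ F}

lemma headPart_mem (a : ZMod p) (hc : c ∈ chains F s D (j + 1)) :
    headPart r a c ∈ chains F s D (j + 1) := by
  refine map_chains_le (fun l h1 h2 h3 ↦ ?_) hc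
  rcases l with _ | ⟨x, l⟩
  · simp at h1
  rw [headPart_single]
  split_ifs
  · exact single_mem_chains h1 h2 h3
  · exact Submodule.zero_mem _

lemma sum_headPart [NeZero p] (ρ : ZMod p ≃ ZMod p) (hc : c ∈ chains F s D (j + 1)) :
    ∑ i ∈ Finset.range p, headPart r (ρ i) c = c := by
  rw [← LinearMap.sum_apply]
  refine chains_congr (ψ := LinearMap.id) (fun l h1 h2 h3 ↦ ?_) hc
  rcases l with _ | ⟨x, l⟩
  · simp at h1
  rw [LinearMap.sum_apply, Finset.sum_eq_single (ρ.symm (r x)).val]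
  · simp [headPart_single]
  · intro i hi hne
    rw [headPart_single, if_neg]
    rintro h
    apply hne
    rw [h, Equiv.symm_apply_apply, ZMod.val_natCast_of_lt (Finset.mem_range.1 hi)]
  · intro h
    exact absurd (Finset.mem_range.2 (ZMod.val_lt _)) h

lemma push_pow_headPart {g : β → β} (hg : ∀ x ∈ D, g x ∈ D) (hr : ∀ x ∈ D, r (g x) = r x + 1)
    (i : ℕ) (a : ZMod p) (hc : c ∈ chains F s D (j + 1)) :
    (pushEnd F g ^ i) (headPart r a c)
      = headPart r (a + i) ((pushEnd F g ^ i) c) := by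
  have hri (x : β) (hx : x ∈ D) : g^[i] x ∈ D ∧ r (g^[i] x) = r x + i := by
    induction i with
    | zero => simpa
    | succ i ih =>
      rw [Function.iterate_succ_apply']
      refine ⟨hg _ ih.1, ?_⟩
      rw [hr _ ih.1, ih.2]
      push_cast
      ring
  rw [pushEnd_pow]
  refine chains_congr (φ := push F g^[i] ∘ₗ headPart r a)
    (ψ := headPart r (a + i) ∘ₗ push F g^[i]) (fun l h1 h2 h3 ↦ ?_) hc
  rcases l with _ | ⟨x, l⟩
  · simp at h1
  simp only [LinearMap.comp_apply, push_single, List.map_cons, headPart_single,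
    (hri x (h3 x (by simp))).2, add_left_inj]
  split_ifs <;> simp

/-- Exactness of the periodic resolution on a free module. -/
lemma exists_periodic_of_eq_zero [NeZero p] {g : β → β} (hg : ∀ x ∈ D, g x ∈ D)
    (hgs : ∀ x y, s x y → s (g x) (g y)) (hr : ∀ x ∈ D, r (g x) = r x + 1) (k : ℕ)
    (hc : c ∈ chains F s D (j + 1)) (h0 : periodic p (pushEnd F g) k c = 0) :
    ∃ b ∈ chains F s D (j + 1), periodic p (pushEnd F g) (k + 1) b = c := by
  set t := pushEnd F g with ht
  by_cases hk : Even k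
  · have htc : t c = c := by simpa [periodic, hk, sub_eq_zero] using h0
    have hpow (i : ℕ) : (t ^ i) c = c := by
      induction i with
      | zero => simp
      | succ i ih => rw [pow_succ', Module.End.mul_apply, ih, htc]
    refine ⟨headPart r 0 c, headPart_mem 0 hc, ?_⟩
    rw [periodic, if_neg (by simpa [Nat.even_add_one] using hk), LinearMap.sum_apply]
    conv_rhs => rw [← sum_headPart (r := r) (Equiv.refl _) hc]
    refine Finset.sum_congr rfl fun i _ ↦ ?_
    rw [push_pow_headPart hg hr i 0 hc, ← ht, hpow]
    simp
  · have hN : ∑ i ∈ Finset.range p, (t ^ i) c = 0 := by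
      simpa [periodic, hk, LinearMap.sum_apply] using h0
    refine ⟨-∑ i ∈ Finset.range p, (∑ m ∈ Finset.range i, t ^ m) (headPart r (-(i : ZMod p)) c),
      Submodule.neg_mem _ (Submodule.sum_mem _ fun i _ ↦ ?_), ?_⟩
    · rw [LinearMap.sum_apply]
      refine Submodule.sum_mem _ fun m hm ↦ ?_
      clear hm
      have := headPart_mem (r := r) (-(i : ZMod p)) hc
      generalize headPart r (-(i : ZMod p)) c = y at this
      induction m with
      | zero => simpa
      | succ m ih =>
        rw [pow_succ', Module.End.mul_apply]
        exact push_mem_chains hg (fun x _ y _ ↦ hgs x y) ih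
    · rw [periodic, if_pos (by simpa [Nat.even_add_one] using hk), map_neg, map_sum]
      have h1 (i : ℕ) : (t - 1) ((∑ m ∈ Finset.range i, t ^ m) (headPart r (-(i : ZMod p)) c))
          = headPart r 0 ((t ^ i) c) - headPart r (-(i : ZMod p)) c := by
        have h2 : (t - 1) * ∑ m ∈ Finset.range i, t ^ m = t ^ i - 1 := mul_geom_sum t i
        rw [← Module.End.mul_apply, h2, LinearMap.sub_apply,
          push_pow_headPart hg hr i _ hc]
        simp [← ht]
      simp_rw [h1]
      rw [Finset.sum_sub_distrib, ← map_sum, hN, map_zero, zero_sub, neg_neg]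
      simpa using sum_headPart (r := r) (Equiv.neg _) hc

end Free

/-- A version of Dold's theorem for posets with a `ZMod p`-symmetry: there is no equivariant
monotone map from an `n`-acyclic poset to a free poset of dimension less than `n`. -/
theorem not_acyclic_of_map (F : Type*) [Field F] [NeZero p] [CharP F p] {α β : Type*}
    [Preorder α] [PartialOrder β] {P : Set α}
    {D : Set β} {n : ℕ} (g : α →o α) (hg : ∀ x ∈ P, g x ∈ P) (hgp : g^[p] = id)
    (g' : β ≃o β) (hg' : ∀ x ∈ D, g' x ∈ D) (r : β → ZMod p) (hr : ∀ x ∈ D, r (g' x) = r x + 1)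
    (hn : ∀ l : List β, l.Pairwise (· > ·) → (∀ x ∈ l, x ∈ D) → l.length ≤ n)
    (f : α →o β) (hf : ∀ x ∈ P, f x ∈ D) (hfg : ∀ x, f (g x) = g' (f x)) :
    ¬ Acyclic F P (n + 1) := by
  intro hP
  obtain ⟨c, h0, h1, h2⟩ := exists_periodic_chain hP g hg hgp
  set t := pushEnd F g' with ht
  let a : ℕ → (List β →₀ F) := fun j ↦ strictPart (push F f (c j))
  have hpush {k : ℕ} {x : List α →₀ F} (hx : x ∈ chains F (· ≥ ·) P k) :
      push F f x ∈ chains F (· ≥ ·) D k :=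
    push_mem_chains (r := (· ≥ ·)) (s := (· ≥ ·)) hf (fun _ _ _ _ h ↦ f.mono h) hx
  have ha (j : ℕ) (hj : j ≤ n) : a j ∈ chains F (· > ·) D (j + 1) :=
    strictPart_mem (hpush (h1 j hj))
  have ha0 : bdry F (a 0) = Finsupp.single [] 1 := by
    rw [← strictPart_bdry (hpush (h1 0 (Nat.zero_le _))), bdry_push, h0]
    simp [strictPart_single]
  have hda (j : ℕ) (hj : j < n) : bdry F (a (j + 1)) = periodic p t j (a j) := by
    have hs (x : List β →₀ F) : strictPart (t x) = t (strictPart x) := by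
      have : strictPart ∘ₗ t = t ∘ₗ strictPart := by
        refine linearMap_ext_single fun l ↦ ?_
        have h : (l.map g').Pairwise (· > ·) ↔ l.Pairwise (· > ·) := by
          simp [List.pairwise_map]
        by_cases hl : l.Pairwise (· > ·)
        · rw [LinearMap.comp_apply, LinearMap.comp_apply, ht, pushEnd_apply, pushEnd_apply,
            push_single, strictPart_single, strictPart_single, if_pos hl, if_pos (h.2 hl),
            push_single]
        · rw [LinearMap.comp_apply, LinearMap.comp_apply, ht, pushEnd_apply, pushEnd_apply,
            push_single, strictPart_single, strictPart_single, if_neg hl, if_neg (mt h.1 hl),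
            map_zero]
      exact LinearMap.congr_fun this x
    have hf (x : List α →₀ F) : push F f (pushEnd F g x) = t (push F f x) := by
      have : push F f ∘ₗ pushEnd F g = t ∘ₗ push F f := by
        refine linearMap_ext_single fun l ↦ ?_
        have h : f ∘ g = g' ∘ f := funext hfg
        simp [ht, pushEnd_apply, h]
      exact LinearMap.congr_fun this x
    rw [← strictPart_bdry (hpush (h1 (j + 1) hj)), bdry_push, h2 j hj,
      periodic_comm hf, periodic_comm hs]
  have hdt (k : ℕ) (x : List β →₀ F) : bdry F (periodic p t k x) = periodic p t k (bdry F x) :=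
    bdry_periodic_pushEnd g' k x
  have htmem {k j : ℕ} {x : List β →₀ F} (hx : x ∈ chains F (· > ·) D j) :
      periodic p t k x ∈ chains F (· > ·) D j :=
    periodic_pushEnd_mem_chains (r := (· > ·)) hg' (fun _ _ h ↦ g'.strictMono h) k hx
  have key (k : ℕ) (hk : k ≤ n) : ∃ b ∈ chains F (· > ·) D (n - k + 2),
      ∃ b' ∈ chains F (· > ·) D (n - k + 1),
      a (n - k) = bdry F b + periodic p t (n - k + 1) b' := by
    induction k with
    | zero =>
      refine ⟨0, Submodule.zero_mem _, 0, Submodule.zero_mem _, ?_⟩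
      have : a n = 0 := by
        have := ha n le_rfl
        rw [chains, Finsupp.mem_supported] at this
        rw [← Finsupp.support_eq_empty, Finset.eq_empty_iff_forall_notMem]
        intro l hl
        obtain ⟨h1, h2, h3⟩ := this hl
        have := hn l h2 h3
        omega
      simpa using this
    | succ k ih =>
      obtain ⟨b, hb, b', hb', hab⟩ := ih (by omega)
      obtain ⟨m, hm⟩ : ∃ m, n - k = m + 1 := ⟨n - k - 1, by omega⟩
      have hm' : n - (k + 1) = m := by omega
      rw [hm] at hb' hab
      rw [hm']
      have hd := hda m (by omega)
      rw [hab, map_add, bdry_bdry, zero_add, hdt, periodic_add_two] at hd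
      have hb'' : bdry F b' ∈ chains F (· > ·) D (m + 1) := bdry_mem_chains hb'
      have hz : periodic p t m (a m - bdry F b') = 0 := by rw [map_sub, hd, sub_self]
      obtain ⟨y, hy, hya⟩ := exists_periodic_of_eq_zero (r := r) (s := (· > ·)) hg'
        (fun x y h ↦ g'.strictMono h) hr m (Submodule.sub_mem _ (ha m (by omega)) hb'') hz
      exact ⟨b', hb', y, hy, by rw [← ht] at hya; rw [hya]; abel⟩
  obtain ⟨b, -, b', hb', hab⟩ := key n le_rfl
  rw [Nat.sub_self] at hb' hab
  rw [hab, map_add, bdry_bdry, zero_add, hdt] at ha0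
  have hzero : periodic p t 1 (bdry F b') = 0 := by
    refine chains_congr (φ := periodic p t 1) (ψ := 0) (fun l h1 _ _ ↦ ?_) (bdry_mem_chains hb')
    obtain rfl := List.length_eq_zero_iff.1 h1
    have : ∀ i, (t ^ i) (Finsupp.single ([] : List β) (1 : F)) = Finsupp.single [] 1 := by
      intro i
      rw [ht, pushEnd_pow, pushEnd_apply]
      simp
    simp [periodic, LinearMap.sum_apply, this]
  rw [zero_add, hzero] at ha0
  simpa using ha0.symm

end Cyclic

end ListChain

namespace SmallSimplices

open ListChain Topology

section SmallSets

variable {ι : Type*} [Fintype ι]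

/-- The coordinates that are nonzero at some point of `T`. -/
def coordSupport (T : Finset (ι → ℝ)) : Set ι := {i | ∃ x ∈ T, x i ≠ 0}

/-- Nonempty finite subsets of the standard simplex of diameter less than `δ` whose coordinate
support belongs to `S`. -/
def smallSets (S : Set (Set ι)) (δ : ℝ) : Set (Finset (ι → ℝ)) :=
  {T | T.Nonempty ∧ (∀ x ∈ T, x ∈ stdSimplex ℝ ι) ∧ (∀ x ∈ T, ∀ y ∈ T, dist x y < δ) ∧
    coordSupport T ∈ S}

lemma smallSets_inter (S S' : Set (Set ι)) (δ : ℝ) :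
    smallSets (S ∩ S') δ = smallSets S δ ∩ smallSets S' δ := by
  ext T
  simp only [smallSets, Set.mem_ofPred_eq, Set.mem_inter_iff]
  tauto

lemma smallSets_union (S S' : Set (Set ι)) (δ : ℝ) :
    smallSets (S ∪ S') δ = smallSets S δ ∪ smallSets S' δ := by
  ext T
  simp only [smallSets, Set.mem_ofPred_eq, Set.mem_union]
  tauto

omit [Fintype ι] in
lemma coordSupport_mono {T T' : Finset (ι → ℝ)} (h : T ⊆ T') :
    coordSupport T ⊆ coordSupport T' := by
  rintro i ⟨x, hx, hi⟩
  exact ⟨x, h hx, hi⟩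

lemma smallSets_of_subset {S : Set (Set ι)} (hS : IsLowerSet S) {δ : ℝ} {T T' : Finset (ι → ℝ)}
    (hT : T.Nonempty) (h : T ≤ T') (hT' : T' ∈ smallSets S δ) : T ∈ smallSets S δ :=
  ⟨hT, fun x hx ↦ hT'.2.1 x (h hx), fun x hx y hy ↦ hT'.2.2.1 x (h hx) y (h hy),
    hS (coordSupport_mono h) hT'.2.2.2⟩

lemma exists_chains_smallSets_lt {F : Type*} [Field F] {S : Set (Set ι)} {δ : ℝ} (hδ : 0 < δ)
    {r : Finset (ι → ℝ) → Finset (ι → ℝ) → Prop} {j : ℕ} {c : List (Finset (ι → ℝ)) →₀ F}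
    (hc : c ∈ chains F r (smallSets S δ) j) :
    ∃ δ' < δ, 0 < δ' ∧ c ∈ chains F r (smallSets S δ') j := by
  rw [chains, Finsupp.mem_supported] at hc
  have h1 : ∀ᶠ δ' in 𝓝[<] δ, ∀ l ∈ c.support, ∀ T ∈ l, T ∈ smallSets S δ' := by
    rw [Filter.eventually_all_finset]
    intro l hl
    have := (hc hl).2.2
    have h2 : ∀ᶠ δ' in 𝓝[<] δ, ∀ T ∈ l.toFinset, T ∈ smallSets S δ' := by
      rw [Filter.eventually_all_finset]
      intro T hT
      have hT := this T (by simpa using hT)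
      have h3 : ∀ᶠ δ' in 𝓝[<] δ, ∀ x ∈ T, ∀ y ∈ T, dist x y < δ' := by
        simp_rw [Filter.eventually_all_finset]
        intro x hx y hy
        exact mem_nhdsWithin_of_mem_nhds (lt_mem_nhds (hT.2.2.1 x hx y hy))
      filter_upwards [h3] with δ' h3
      exact ⟨hT.1, hT.2.1, h3, hT.2.2.2⟩
    simpa using h2
  have h4 : ∀ᶠ δ' in 𝓝[<] δ, 0 < δ' := mem_nhdsWithin_of_mem_nhds (lt_mem_nhds hδ)
  obtain ⟨δ', h1, h4, h5⟩ := (h1.and (h4.and self_mem_nhdsWithin)).exists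
  refine ⟨δ', h5, h4, ?_⟩
  rw [chains, Finsupp.mem_supported]
  exact fun l hl ↦ ⟨(hc hl).1, (hc hl).2.1, h1 l hl⟩

lemma dist_le_one_of_mem_stdSimplex {x y : ι → ℝ} (hx : x ∈ stdSimplex ℝ ι)
    (hy : y ∈ stdSimplex ℝ ι) : dist x y ≤ 1 := by
  rw [dist_pi_le_iff zero_le_one]
  intro i
  have hle {z : ι → ℝ} (hz : z ∈ stdSimplex ℝ ι) : z i ≤ 1 := by
    rw [← hz.2]
    exact Finset.single_le_sum (fun i _ ↦ hz.1 i) (Finset.mem_univ i)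
  rw [Real.dist_eq, abs_le]
  constructor <;> linarith [hx.1 i, hy.1 i, hle hx, hle hy]

open Classical in
/-- Contraction of finite sets towards the vertex `w`. -/
noncomputable def contract (w : ι) (s : ℝ) : Finset (ι → ℝ) →o Finset (ι → ℝ) where
  toFun T := T.image fun x ↦ AffineMap.lineMap x (Pi.single w 1) s
  monotone' _ _ h := Finset.image_subset_image h

open Classical in
lemma contract_apply (w : ι) (s : ℝ) (T : Finset (ι → ℝ)) :
    contract w s T = T.image fun x ↦ AffineMap.lineMap x (Pi.single w 1) s := rfl

open Classical in
lemma contract_union_mem {S : Set (Set ι)} (hS : IsLowerSet S) {w : ι}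
    (hw : ∀ σ ∈ S, insert w σ ∈ S) {δ δ' s s' : ℝ} (hs : s ∈ Set.Icc 0 1) (hs' : s' ∈ Set.Icc 0 1)
    (hδ : δ' + |s - s'| < δ) {T : Finset (ι → ℝ)} (hT : T ∈ smallSets S δ') :
    contract w s T ∪ contract w s' T ∈ smallSets S δ := by
  obtain ⟨h1, h2, h3, h4⟩ := hT
  have hw1 : Pi.single w 1 ∈ stdSimplex ℝ ι := single_mem_stdSimplex ℝ w
  have hlin {t : ℝ} (ht : t ∈ Set.Icc (0 : ℝ) 1) {x : ι → ℝ} (hx : x ∈ T) :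
      AffineMap.lineMap x (Pi.single w 1) t ∈ stdSimplex ℝ ι :=
    (convex_stdSimplex ℝ ι).lineMap_mem (h2 x hx) hw1 ht
  have hd {t : ℝ} (ht : t ∈ Set.Icc (0 : ℝ) 1) {x y : ι → ℝ} (hx : x ∈ T) (hy : y ∈ T) :
      dist (AffineMap.lineMap x (Pi.single w 1) t : ι → ℝ)
        (AffineMap.lineMap y (Pi.single w 1) t) < δ' := by
    refine lt_of_le_of_lt ?_ (h3 x hx y hy)
    have : (AffineMap.lineMap x (Pi.single w 1) t : ι → ℝ) - AffineMap.lineMap y (Pi.single w 1) t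
        = (1 - t) • (x - y) := by
      simp only [AffineMap.lineMap_apply_module]
      module
    rw [dist_eq_norm, this, norm_smul, dist_eq_norm, Real.norm_of_nonneg (by linarith [ht.2])]
    exact mul_le_of_le_one_left (norm_nonneg _) (by linarith [ht.1])
  have hd' {t t' : ℝ} (ht : t ∈ Set.Icc (0 : ℝ) 1) (h : |t - t'| = |s - s'|) {x y : ι → ℝ}
      (hx : x ∈ T) (hy : y ∈ T) :
      dist (AffineMap.lineMap x (Pi.single w 1) t : ι → ℝ)
        (AffineMap.lineMap y (Pi.single w 1) t') < δ := by
    refine lt_of_le_of_lt ((dist_triangle _ (AffineMap.lineMap y (Pi.single w 1) t) _).trans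
      (add_le_add (hd ht hx hy).le (?_ : _ ≤ |s - s'|))) hδ
    rw [dist_lineMap_lineMap, Real.dist_eq, h]
    exact mul_le_of_le_one_right (abs_nonneg _) (dist_le_one_of_mem_stdSimplex (h2 y hy) hw1)
  have hδ' : δ' < δ := by linarith [abs_nonneg (s - s')]
  refine ⟨(h1.image _).mono Finset.subset_union_left, ?_, ?_, ?_⟩
  · intro x hx
    simp only [contract_apply, Finset.mem_union, Finset.mem_image] at hx
    rcases hx with ⟨x, hx, rfl⟩ | ⟨x, hx, rfl⟩
    exacts [hlin hs hx, hlin hs' hx]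
  · intro x hx y hy
    simp only [contract_apply, Finset.mem_union, Finset.mem_image] at hx hy
    rcases hx with ⟨x, hx, rfl⟩ | ⟨x, hx, rfl⟩ <;> rcases hy with ⟨y, hy, rfl⟩ | ⟨y, hy, rfl⟩
    exacts [(hd hs hx hy).trans hδ', hd' hs rfl hx hy, hd' hs' (abs_sub_comm _ _) hx hy,
      (hd hs' hx hy).trans hδ']
  · refine hS ?_ (hw _ h4)
    rintro i ⟨x, hx, hi⟩
    simp only [contract_apply, Finset.mem_union, Finset.mem_image] at hx
    by_contra hiw
    simp only [Set.mem_insert_iff, not_or] at hiw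
    have hz {t : ℝ} {y : ι → ℝ} (hy : y ∈ T) :
        (AffineMap.lineMap y (Pi.single w 1) t : ι → ℝ) i = 0 := by
      have : y i = 0 := by
        by_contra h
        exact hiw.2 ⟨y, hy, h⟩
      simp [AffineMap.lineMap_apply_module, this, hiw.1]
    rcases hx with ⟨x, hx, rfl⟩ | ⟨x, hx, rfl⟩ <;> exact hi (hz hx)

open Classical in
/-- The sets supported in a cone are acyclic. -/
lemma acyclic_smallSets_of_cone {F : Type*} [Field F] {S : Set (Set ι)} (hS : IsLowerSet S)
    {w : ι} (hne : S.Nonempty) (hw : ∀ σ ∈ S, insert w σ ∈ S) {δ : ℝ} (hδ : 0 < δ) (a : ℕ) :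
    Acyclic F (smallSets S δ) a := by
  intro j _ c hc hz
  obtain ⟨δ', hδ', hδ0, hc'⟩ := exists_chains_smallSets_lt hδ hc
  obtain ⟨N, hN⟩ := exists_nat_one_div_lt (sub_pos.2 hδ')
  have hN0 : (0 : ℝ) < N + 1 := by positivity
  have step (k : ℕ) (hk : k ≤ N + 1) : ∃ b ∈ chains F (· ≥ ·) (smallSets S δ) (j + 1),
      bdry F b = push F (contract w (k / (N + 1))) c - c := by
    induction k with
    | zero =>
      refine ⟨0, Submodule.zero_mem _, ?_⟩
      have : ⇑(contract w (((0 : ℕ) : ℝ) / (N + 1))) = id := by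
        ext T : 1
        simp [contract_apply]
      rw [this]
      simp [push]
    | succ k ih =>
      obtain ⟨b, hb, hbc⟩ := ih (by omega)
      set s : ℝ := k / (N + 1) with hs
      set s' : ℝ := (k + 1 : ℕ) / (N + 1) with hs'
      have hk' : (k : ℝ) + 1 ≤ N + 1 := by exact_mod_cast hk
      have hsI : s ∈ Set.Icc (0 : ℝ) 1 := ⟨by positivity, by rw [hs, div_le_one hN0]; linarith⟩
      have hsI' : s' ∈ Set.Icc (0 : ℝ) 1 :=
        ⟨by positivity, by rw [hs', div_le_one hN0]; exact_mod_cast hk⟩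
      have hss : |s - s'| = 1 / (N + 1) := by
        rw [abs_sub_comm, hs, hs', ← sub_div]
        push_cast
        rw [add_sub_cancel_left, abs_of_pos (by positivity)]
      let u : Finset (ι → ℝ) →o Finset (ι → ℝ) := contract w s ⊔ contract w s'
      have hu : ∀ T ∈ smallSets S δ', u T ∈ smallSets S δ := fun T hT ↦
        contract_union_mem hS hw hsI hsI' (by rw [hss]; linarith) hT
      have hone {t : ℝ} (ht : t ∈ Set.Icc (0 : ℝ) 1) :
          ∀ T ∈ smallSets S δ', contract w t T ∈ smallSets S δ := fun T hT ↦ by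
        have := contract_union_mem hS hw (δ := δ) ht ht (by simpa using hδ') hT
        rwa [Finset.union_self] at this
      obtain ⟨b1, hb1, hbc1⟩ := push_sub_push_eq_bdry (le_sup_left : contract w s ≤ u) hu
        (hone hsI) hc' hz
      obtain ⟨b2, hb2, hbc2⟩ := push_sub_push_eq_bdry (le_sup_right : contract w s' ≤ u) hu
        (hone hsI') hc' hz
      refine ⟨b + (b2 - b1), Submodule.add_mem _ hb (Submodule.sub_mem _ hb2 hb1), ?_⟩
      rw [map_add, map_sub, hbc, hbc1, hbc2]
      abel
  obtain ⟨b, hb, hbc⟩ := step (N + 1) le_rfl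
  set e : Finset (ι → ℝ) := {Pi.single w 1} with he
  have hgT : ∀ T ∈ smallSets S δ, contract w (((N + 1 : ℕ) : ℝ) / (N + 1)) T = e := by
    intro T hT
    have : ((N + 1 : ℕ) : ℝ) / (N + 1) = 1 := by push_cast; field_simp
    rw [this]
    simp only [contract_apply, AffineMap.lineMap_apply_one]
    exact Finset.image_const hT.1 _
  have hmem : e ∈ smallSets S δ := by
    refine ⟨by simp [he], by simpa [he] using single_mem_stdSimplex ℝ w, by simpa [he] using hδ, ?_⟩
    obtain ⟨σ, hσ⟩ := hne
    refine hS ?_ (hw σ hσ)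
    rintro i ⟨x, hx, hi⟩
    rw [he, Finset.mem_singleton] at hx
    subst hx
    by_cases h : i = w
    · exact Or.inl h
    · simp [h] at hi
  have hpush : push F (contract w (((N + 1 : ℕ) : ℝ) / (N + 1))) c
      ∈ chains F (· ≥ ·) {T | T ∈ smallSets S δ ∧ e ≥ T} j :=
    push_mem_chains (r := (· ≥ ·)) (s := (· ≥ ·))
      (fun T hT ↦ by rw [hgT T hT]; exact ⟨hmem, le_rfl⟩)
      (fun T _ T' _ h ↦ (contract w _).mono h) hc
  refine ⟨prepend F e (push F (contract w (((N + 1 : ℕ) : ℝ) / (N + 1))) c) - b,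
    Submodule.sub_mem _ (prepend_mem_chains hmem hpush) hb, ?_⟩
  rw [map_sub, bdry_prepend, bdry_push, hz, hbc]
  simp

/-- The nerve-type lemma for the order complexes of small sets. -/
lemma acyclic_smallSets_biUnion {F : Type*} [Field F] {κ : Type*} [DecidableEq κ] {δ : ℝ}
    {I : Finset κ} (hI : I.Nonempty) : ∀ {S : κ → Set (Set ι)} {a : ℕ},
    (∀ i, IsLowerSet (S i)) → (∀ J ⊆ I, J.Nonempty →
      Acyclic F (smallSets (⋂ i ∈ J, S i) δ) (a + 1 - J.card)) →
    Acyclic F (smallSets (⋃ i ∈ I, S i) δ) a := by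
  induction hI using Finset.Nonempty.cons_induction with
  | singleton i =>
    intro S a _ h
    simpa using h {i} (by simp) (by simp)
  | cons i I hi hI ih =>
    intro S a hS h
    rw [Finset.cons_eq_insert] at h ⊢
    rw [Finset.set_biUnion_insert, smallSets_union]
    have hU : IsLowerSet (⋃ i ∈ I, S i) := isLowerSet_iUnion₂ fun i _ ↦ hS i
    refine Acyclic.union (fun T hT T' hT' hle ↦ smallSets_of_subset (hS i) hT.1 hle hT')
      (fun T hT T' hT' hle ↦ smallSets_of_subset hU hT.1 hle hT') ?_ ?_ ?_
    · simpa using h {i} (by simp) (by simp)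
    · exact ih hS fun J hJ hne ↦ h J (hJ.trans (Finset.subset_insert _ _)) hne
    · rw [← smallSets_inter, Set.inter_iUnion₂]
      refine ih (fun k ↦ (hS i).inter (hS k)) fun J hJ hne ↦ ?_
      have h' := h (insert i J) (Finset.insert_subset_insert _ hJ) (by simp)
      have : ⋂ k ∈ J, S i ∩ S k = ⋂ k ∈ insert i J, S k := by
        obtain ⟨m, hm⟩ := hne
        ext σ
        simp only [Set.mem_iInter, Set.mem_inter_iff, Finset.mem_insert, forall_eq_or_imp]
        exact ⟨fun h ↦ ⟨(h m hm).1, fun k hk ↦ (h k hk).2⟩, fun h k hk ↦ ⟨h.1, h.2 k hk⟩⟩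
      rw [this]
      refine h'.mono ?_
      rw [Finset.card_insert_of_notMem fun h ↦ hi (hJ h)]
      have := hne.card_pos
      omega

end SmallSets

section Colorings

variable {V C : Type*} [Fintype V] [DecidableEq V] [Fintype C] [DecidableEq C]

/-- Partial proper colourings of `G` (as graphs of functions) that colour only vertices of `W`,
each from its own list `A v`. -/
def listColorings (G : SimpleGraph V) (W : Finset V) (A : V → Finset C) : Set (Set (V × C)) :=
  {σ | (∀ v i, (v, i) ∈ σ → v ∈ W ∧ i ∈ A v) ∧ (∀ v i j, (v, i) ∈ σ → (v, j) ∈ σ → i = j) ∧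
    ∀ u v i, (u, i) ∈ σ → (v, i) ∈ σ → ¬ G.Adj u v}

omit [Fintype V] [DecidableEq V] [Fintype C] [DecidableEq C] in
lemma isLowerSet_listColorings (G : SimpleGraph V) (W : Finset V) (A : V → Finset C) :
    IsLowerSet (listColorings G W A) := fun _ _ h hσ ↦
  ⟨fun v i hv ↦ hσ.1 v i (h hv), fun v i j hi hj ↦ hσ.2.1 v i j (h hi) (h hj),
    fun u v i hu hv ↦ hσ.2.2 u v i (h hu) (h hv)⟩

variable (G : SimpleGraph V) [DecidableRel G.Adj] {W : Finset V} {A : V → Finset C} {v : V}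

omit [Fintype V] [DecidableEq V] [Fintype C] [DecidableEq C] [DecidableRel G.Adj] in
lemma insert_mem_listColorings {σ : Set (V × C)} (hσ : σ ∈ listColorings G W A) (hv : v ∈ W)
    {i : C} (hi : i ∈ A v) (h1 : ∀ j, (v, j) ∈ σ → j = i) (h2 : ∀ u, G.Adj v u → (u, i) ∉ σ) :
    insert (v, i) σ ∈ listColorings G W A := by
  simp only [listColorings, Set.mem_ofPred_eq, Set.mem_insert_iff, Prod.mk.injEq] at hσ ⊢
  refine ⟨?_, ?_, ?_⟩
  · rintro u j (⟨rfl, rfl⟩ | h)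
    exacts [⟨hv, hi⟩, hσ.1 u j h]
  · rintro u j k (⟨rfl, rfl⟩ | h) (⟨hu, rfl⟩ | h')
    · rfl
    · exact (h1 _ h').symm
    · subst hu
      exact h1 _ h
    · exact hσ.2.1 _ _ _ h h'
  · rintro u x j (⟨rfl, rfl⟩ | h) (⟨rfl, h'⟩ | h')
    · exact G.irrefl
    · exact fun hadj ↦ h2 _ hadj h'
    · exact fun hadj ↦ h2 _ hadj.symm (h' ▸ h)
    · exact hσ.2.2 _ _ _ h h'

omit [DecidableEq V] [Fintype C] [DecidableEq C] in
lemma exists_insert_mem_listColorings (hv : v ∈ W) (hA : G.maxDegree < (A v).card)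
    {σ : Set (V × C)} (hσ : σ ∈ listColorings G W A) :
    ∃ i ∈ A v, insert (v, i) σ ∈ listColorings G W A := by
  have : Nonempty V := ⟨v⟩
  by_cases h : ∃ i, (v, i) ∈ σ
  · obtain ⟨i, hi⟩ := h
    exact ⟨i, (hσ.1 v i hi).2, by rwa [Set.insert_eq_of_mem hi]⟩
  push Not at h
  by_contra! hcon
  have h1 : ∀ i ∈ A v, ∃ u ∈ G.neighborFinset v, (u, i) ∈ σ := by
    intro i hi
    by_contra! h2
    exact hcon i hi (insert_mem_listColorings G hσ hv hi (fun j hj ↦ (h j hj).elim)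
      fun u hu ↦ h2 u (by simpa using hu))
  choose! g hg hgσ using h1
  have := Finset.card_le_card_of_injOn g hg fun i hi j hj hij ↦
    hσ.2.1 (g i) i j (hgσ i hi) (hij ▸ hgσ j hj)
  rw [G.card_neighborFinset_eq_degree] at this
  have := G.degree_le_maxDegree v
  omega

omit [DecidableEq V] [Fintype C] [DecidableEq C] in
lemma listColorings_eq_biUnion (hv : v ∈ W) (hA : G.maxDegree < (A v).card) :
    listColorings G W A = ⋃ i ∈ A v, {σ | insert (v, i) σ ∈ listColorings G W A} := by
  ext σ
  simp only [Set.mem_iUnion, Set.mem_ofPred_eq, exists_prop]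
  refine ⟨exists_insert_mem_listColorings G hv hA, ?_⟩
  rintro ⟨i, -, h⟩
  exact isLowerSet_listColorings G W A (Set.subset_insert _ _) h

omit [Fintype C] [Fintype V] in
lemma biInter_insert_mem_listColorings (hv : v ∈ W) {J : Finset C} (hJ : J ⊆ A v)
    (hJ1 : 1 < J.card) :
    ⋂ i ∈ J, {σ | insert (v, i) σ ∈ listColorings G W A}
      = listColorings G (W.erase v) fun u ↦ if G.Adj v u then A u \ J else A u := by
  obtain ⟨i, hi, j, hj, hij⟩ := Finset.one_lt_card.1 hJ1
  ext σ
  simp only [Set.mem_iInter, Set.mem_ofPred_eq]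
  constructor
  · intro h
    have hσ := isLowerSet_listColorings G W A (Set.subset_insert _ _) (h i hi)
    refine ⟨fun u k hu ↦ ⟨Finset.mem_erase.2 ⟨?_, (hσ.1 u k hu).1⟩, ?_⟩, hσ.2⟩
    · rintro rfl
      refine hij (((h i hi).2.1 u i k (by simp) (by simp [hu])).trans
        ((h j hj).2.1 u j k (by simp) (by simp [hu])).symm)
    · beta_reduce
      split_ifs with hadj
      · refine Finset.mem_sdiff.2 ⟨(hσ.1 u k hu).2, fun hk ↦ ?_⟩
        exact (h k hk).2.2 v u k (by simp) (by simp [hu]) hadj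
      · exact (hσ.1 u k hu).2
  · intro hσ k hk
    have hσ' : σ ∈ listColorings G W A := by
      refine ⟨fun u m hu ↦ ?_, hσ.2⟩
      obtain ⟨h1, h2⟩ := hσ.1 u m hu
      refine ⟨Finset.mem_of_mem_erase h1, ?_⟩
      beta_reduce at h2
      split_ifs at h2
      exacts [(Finset.mem_sdiff.1 h2).1, h2]
    refine insert_mem_listColorings G hσ' hv (hJ hk) (fun m hm ↦ ?_) fun u hu hmem ↦ ?_
    · exact absurd (hσ.1 v m hm).1 (Finset.notMem_erase v W)
    · have := (hσ.1 u k hmem).2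
      simp [hu, hk] at this

/-- Small sets supported on partial proper list colourings form an acyclic poset, in a range of
degrees governed by the sizes of the lists. -/
theorem acyclic_listColorings (F : Type*) [Field F] {δ : ℝ} (hδ : 0 < δ) :
    ∀ (n : ℕ) (W : Finset V) (A : V → Finset C) (a : ℕ), W.card = n →
    ∑ v ∈ W, ((Fintype.card C : ℤ) - (A v).card) + (Fintype.card C + G.maxDegree) * (a - 1)
      < (Fintype.card C - G.maxDegree) * n →
    Acyclic F (smallSets (listColorings G W A) δ) a := by
  intro n
  induction n with
  | zero =>
    intro W A a hW h
    obtain rfl := Finset.card_eq_zero.1 hW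
    rcases a with _ | a
    · intro j hj
      omega
    · exfalso
      push_cast at h
      simp only [Finset.sum_empty, zero_add, add_sub_cancel_right, mul_zero] at h
      exact absurd h (not_lt.2 (by positivity))
  | succ n ih =>
    intro W A a hW h
    rcases a with _ | a
    · intro j hj
      omega
    set p : ℤ := (Fintype.card C : ℤ) with hp
    set Δ : ℤ := (G.maxDegree : ℤ) with hΔ
    have hp0 : 0 ≤ p := by positivity
    have hΔ0 : 0 ≤ Δ := by positivity
    push_cast at h
    rw [add_sub_cancel_right] at h
    obtain ⟨v, hv, hA⟩ : ∃ v ∈ W, p - (A v).card < p - Δ := by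
      refine Finset.exists_lt_of_sum_lt ?_
      rw [Finset.sum_const, hW, nsmul_eq_mul]
      have : 0 ≤ (p + Δ) * a := by positivity
      push_cast
      linarith
    have hA' : G.maxDegree < (A v).card := by omega
    rw [listColorings_eq_biUnion G hv hA']
    refine acyclic_smallSets_biUnion (Finset.card_pos.1 (by omega))
      (fun i σ τ h ↦ isLowerSet_listColorings G W A (Set.insert_subset_insert h))
      fun J hJ hne ↦ ?_
    rcases (Nat.succ_le_of_lt hne.card_pos).eq_or_lt with h1 | h1
    · obtain ⟨i, rfl⟩ := Finset.card_eq_one.1 h1.symm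
      simp only [Finset.mem_singleton, Set.iInter_iInter_eq_left]
      refine acyclic_smallSets_of_cone (S := {σ | insert (v, i) σ ∈ listColorings G W A})
        (w := (v, i)) (fun σ τ h ↦ isLowerSet_listColorings G W A (Set.insert_subset_insert h))
        ⟨∅, ?_⟩ (fun σ hσ ↦ ?_) hδ _
      on_goal 2 =>
        rw [Set.mem_ofPred_eq, Set.insert_idem]
        exact hσ
      refine insert_mem_listColorings G ?_ hv (hJ (by simp)) (by simp) (by simp)
      simp [listColorings]
    · rw [biInter_insert_mem_listColorings G hv hJ h1]
      rcases Nat.eq_zero_or_pos (a + 1 + 1 - J.card) with h0 | h0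
      · rw [h0]
        intro j hj
        omega
      refine ih _ _ _ (by rw [Finset.card_erase_of_mem hv]; omega) ?_
      have hk : ((a + 1 + 1 - J.card : ℕ) : ℤ) = a + 2 - J.card := by omega
      set k : ℤ := (J.card : ℤ) with hkdef
      rw [hk]
      have hk2 : 2 ≤ k := by omega
      have hsum : ∑ u ∈ W.erase v, (p - ((if G.Adj v u then A u \ J else A u).card : ℤ))
          ≤ ∑ u ∈ W.erase v, (p - (A u).card) + k * Δ := by
        have h2 : ∀ u ∈ W.erase v, (p - ((if G.Adj v u then A u \ J else A u).card : ℤ))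
            ≤ (p - (A u).card) + if G.Adj v u then k else 0 := by
          intro u _
          split_ifs
          · have := Finset.le_card_sdiff J (A u)
            omega
          · simp
        refine (Finset.sum_le_sum h2).trans ?_
        rw [Finset.sum_add_distrib]
        gcongr
        rw [← Finset.sum_filter, Finset.sum_const, nsmul_eq_mul, mul_comm]
        gcongr
        rw [hΔ]
        have : (W.erase v).filter (G.Adj v) ⊆ G.neighborFinset v := by
          intro u hu
          simpa using (Finset.mem_filter.1 hu).2
        have := Finset.card_le_card this
        rw [G.card_neighborFinset_eq_degree] at this
        exact_mod_cast this.trans (G.degree_le_maxDegree v)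
      have hle : ((A v).card : ℤ) ≤ p := by
        rw [hp]
        exact_mod_cast Finset.card_le_univ _
      have hWv := Finset.sum_erase_add W (fun u ↦ p - ((A u).card : ℤ)) hv
      nlinarith [mul_nonneg (by linarith : (0 : ℤ) ≤ k - 2) hp0]

end Colorings

lemma length_le_of_pairwise_gt {β : Type*} (l : List (Finset β)) :
    ∀ n : ℕ, l.Pairwise (· > ·) → (∀ S ∈ l, S.Nonempty ∧ S.card ≤ n) → l.length ≤ n := by
  induction l with
  | nil => simp
  | cons S l ih =>
    intro n hl h
    rw [List.pairwise_cons] at hl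
    have hS := h S (by simp)
    have h1 := hS.1.card_pos
    have := ih (n - 1) hl.2 fun S' hS' ↦ by
      have := Finset.card_lt_card (hl.1 S' hS')
      exact ⟨(h S' (by simp [hS'])).1, by omega⟩
    rw [List.length_cons]
    omega

section Equivariant

variable {V κ : Type*} {p : ℕ}

/-- Nonempty subsets of `κ × ZMod p` that contain no full row. -/
def deficientSets (κ : Type*) (p : ℕ) : Set (Finset (κ × ZMod p)) :=
  {S | S.Nonempty ∧ ∀ k, ∃ i, (k, i) ∉ S}

lemma card_le_of_mem_deficientSets [Fintype κ] [NeZero p] {S : Finset (κ × ZMod p)}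
    (hS : S ∈ deficientSets κ p) : S.card ≤ Fintype.card κ * (p - 1) := by
  classical
  obtain ⟨-, h⟩ := hS
  choose i hi using h
  have h1 : (Finset.univ.image fun k ↦ (k, i k)) ⊆ Sᶜ := by
    intro a ha
    obtain ⟨k, -, rfl⟩ := Finset.mem_image.1 ha
    simpa using hi k
  have h2 := Finset.card_le_card h1
  rw [Finset.card_image_of_injective _ fun k k' h ↦ congrArg Prod.fst h, Finset.card_univ] at h2
  have h3 := Finset.card_add_card_compl S
  rw [Fintype.card_prod, ZMod.card] at h3
  rw [Nat.mul_sub, mul_one]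
  omega

/-- The shift of the columns of `κ × ZMod p`. -/
def shiftEquiv (κ : Type*) (p : ℕ) : κ × ZMod p ≃ κ × ZMod p :=
  (Equiv.refl κ).prodCongr (Equiv.addRight 1)

lemma mem_map_shiftEquiv {S : Finset (κ × ZMod p)} {k : κ} {i : ZMod p} :
    (k, i) ∈ S.map (shiftEquiv κ p).toEmbedding ↔ (k, i - 1) ∈ S := by
  simp [shiftEquiv, Finset.mem_map_equiv, sub_eq_add_neg]

open Classical in
/-- The mean of the elements of the first nonempty row. -/
noncomputable def rowMean [Nonempty κ] (S : Finset (κ × ZMod p)) : ZMod p :=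
  let R := S.filter fun a ↦ a.1 = Classical.epsilon fun k ↦ ∃ i, (k, i) ∈ S
  (R.card : ZMod p)⁻¹ * ∑ a ∈ R, a.2

lemma rowMean_map_shiftEquiv [Nonempty κ] [Fact p.Prime] {S : Finset (κ × ZMod p)}
    (hS : S ∈ deficientSets κ p) :
    rowMean (S.map (shiftEquiv κ p).toEmbedding) = rowMean S + 1 := by
  classical
  have h1 : (fun k ↦ ∃ i, (k, i) ∈ S.map (shiftEquiv κ p).toEmbedding)
      = fun k ↦ ∃ i, (k, i) ∈ S := by
    ext k
    simp_rw [mem_map_shiftEquiv]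
    exact ⟨fun ⟨i, hi⟩ ↦ ⟨_, hi⟩, fun ⟨i, hi⟩ ↦ ⟨i + 1, by simpa using hi⟩⟩
  have h2 : ∃ k i, (k, i) ∈ S := by
    obtain ⟨⟨k, i⟩, h⟩ := hS.1
    exact ⟨k, i, h⟩
  have h3 := Classical.epsilon_spec h2
  simp only [rowMean, h1]
  set k := Classical.epsilon fun k ↦ ∃ i, (k, i) ∈ S
  set R := S.filter fun a ↦ a.1 = k with hR
  have hmap : (S.map (shiftEquiv κ p).toEmbedding).filter (fun a ↦ a.1 = k)
      = R.map (shiftEquiv κ p).toEmbedding := by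
    rw [Finset.filter_map]
    rfl
  have hpos : R.Nonempty := by
    obtain ⟨i, hi⟩ := h3
    exact ⟨(k, i), by simp [hR, hi]⟩
  have hlt : R.card < p := by
    obtain ⟨i, hi⟩ := hS.2 k
    have hinj : Set.InjOn Prod.snd (R : Set (κ × ZMod p)) := by
      rintro ⟨a, b⟩ hab ⟨a', b'⟩ hab' rfl
      simp only [hR, Finset.coe_filter, Set.mem_ofPred_eq] at hab hab'
      rw [hab.2, hab'.2]
    rw [← Finset.card_image_of_injOn hinj]
    have : R.image Prod.snd ⊂ Finset.univ := by
      rw [Finset.ssubset_univ_iff]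
      intro h
      have : i ∈ R.image Prod.snd := h ▸ Finset.mem_univ i
      obtain ⟨⟨a, b⟩, hab, rfl⟩ := Finset.mem_image.1 this
      simp only [hR, Finset.mem_filter] at hab
      exact hi (hab.2 ▸ hab.1)
    simpa [ZMod.card] using Finset.card_lt_card this
  have hne : (R.card : ZMod p) ≠ 0 := by
    rw [Ne, ZMod.natCast_eq_zero_iff]
    exact fun h ↦ absurd (Nat.le_of_dvd hpos.card_pos h) (not_le.2 hlt)
  rw [hmap, Finset.card_map, Finset.sum_map]
  have : ∀ a ∈ R, ((shiftEquiv κ p).toEmbedding a).2 = a.2 + 1 := fun a _ ↦ rfl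
  rw [Finset.sum_congr rfl this, Finset.sum_add_distrib, mul_add]
  simp [hne]

/-- The shift of the columns of a matrix. -/
def shift (x : V × ZMod p → ℝ) : V × ZMod p → ℝ := fun a ↦ x (a.1, a.2 - 1)

lemma shift_iterate (n : ℕ) (x : V × ZMod p → ℝ) :
    shift^[n] x = fun a ↦ x (a.1, a.2 - n) := by
  induction n with
  | zero => simp
  | succ n ih =>
    rw [Function.iterate_succ_apply', ih]
    ext a
    simp [shift, sub_sub, add_comm]

open Classical in
/-- The shift of the columns, as a map of finite sets of matrices. -/
noncomputable def shiftImage : Finset (V × ZMod p → ℝ) →o Finset (V × ZMod p → ℝ) where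
  toFun := Finset.image shift
  monotone' _ _ h := Finset.image_subset_image h

open Classical in
lemma shiftImage_apply (T : Finset (V × ZMod p → ℝ)) : shiftImage T = T.image shift := rfl

open Classical in
lemma mem_shiftImage {T : Finset (V × ZMod p → ℝ)} {y : V × ZMod p → ℝ} :
    y ∈ shiftImage T ↔ ∃ x ∈ T, shift x = y := by
  rw [shiftImage_apply, Finset.mem_image]

lemma shiftImage_iterate : (shiftImage (V := V) (p := p))^[p] = id := by
  classical
  have (n : ℕ) (T : Finset (V × ZMod p → ℝ)) : shiftImage^[n] T = T.image shift^[n] := by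
    induction n with
    | zero => simp
    | succ n ih =>
      rw [Function.iterate_succ_apply', ih, shiftImage_apply, Finset.image_image,
        Function.iterate_succ']
  ext T : 1
  rw [this]
  have : shift^[p] = (id : (V × ZMod p → ℝ) → _) := by
    ext x a
    simp [shift_iterate]
  simp [this]

variable [Fintype V] [NeZero p]

lemma shiftImage_mem_smallSets {S : Set (Set (V × ZMod p))}
    (hS : ∀ σ ∈ S, {a : V × ZMod p | (a.1, a.2 - 1) ∈ σ} ∈ S) {δ : ℝ}
    {T : Finset (V × ZMod p → ℝ)} (hT : T ∈ smallSets S δ) : shiftImage T ∈ smallSets S δ := by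
  obtain ⟨h1, h2, h3, h4⟩ := hT
  let e : V × ZMod p ≃ V × ZMod p := (Equiv.refl V).prodCongr (Equiv.subRight 1)
  have he (x : V × ZMod p → ℝ) : shift x = x ∘ e := rfl
  refine ⟨?_, fun _ hx ↦ ?_, fun _ hx _ hy ↦ ?_, ?_⟩
  · obtain ⟨x, hx⟩ := h1
    exact ⟨shift x, mem_shiftImage.2 ⟨x, hx, rfl⟩⟩
  · obtain ⟨x, hx', rfl⟩ := mem_shiftImage.1 hx
    refine ⟨fun a ↦ (h2 x hx').1 _, ?_⟩
    rw [← (h2 x hx').2, he]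
    exact Equiv.sum_comp e x
  · obtain ⟨x, hx', rfl⟩ := mem_shiftImage.1 hx
    obtain ⟨y, hy', rfl⟩ := mem_shiftImage.1 hy
    refine lt_of_le_of_lt ?_ (h3 x hx' y hy')
    rw [dist_pi_le_iff dist_nonneg]
    exact fun a ↦ dist_le_pi_dist x y (e a)
  · convert hS _ h4 using 1
    ext a
    simp [coordSupport, mem_shiftImage, shift]

/-- If the small sets supported in `S` form sufficiently connected posets, then a continuous map
to `ℝ^κ` takes equal values at all columns of some matrix supported in `S`. -/
theorem exists_forall_eq_of_acyclic [Fact p.Prime] [Fintype κ] [Nonempty κ]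
    {S : Set (Set (V × ZMod p))} (hS : IsLowerSet S)
    (hSs : ∀ σ ∈ S, {a : V × ZMod p | (a.1, a.2 - 1) ∈ σ} ∈ S)
    (hac : ∀ δ > 0, Acyclic (ZMod p) (smallSets S δ) (Fintype.card κ * (p - 1) + 1))
    {φ : κ → (V → ℝ) → ℝ} (hφ : ∀ k, Continuous (φ k)) :
    ∃ x ∈ stdSimplex ℝ (V × ZMod p), {a | x a ≠ 0} ∈ S ∧
      ∀ k i j, φ k (fun v ↦ x (v, i)) = φ k (fun v ↦ x (v, j)) := by
  classical
  by_contra! hcon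
  let Φ : (V × ZMod p → ℝ) → κ × ZMod p → ℝ := fun x a ↦ φ a.1 fun v ↦ x (v, a.2)
  have hΦ : Continuous Φ := by
    refine continuous_pi fun a ↦ (hφ a.1).comp ?_
    fun_prop
  let X : Set (V × ZMod p → ℝ) := {x | x ∈ stdSimplex ℝ (V × ZMod p) ∧ {a | x a ≠ 0} ∈ S}
  have hX : IsCompact X := by
    have : X = ⋃ σ ∈ S, {x | x ∈ stdSimplex ℝ (V × ZMod p) ∧ ∀ a ∉ σ, x a = 0} := by
      ext x
      simp only [X, Set.mem_iUnion, Set.mem_ofPred_eq, exists_prop]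
      refine ⟨fun h ↦ ⟨_, h.2, h.1, fun a ha ↦ by simpa using ha⟩, ?_⟩
      rintro ⟨σ, hσ, hx, h⟩
      exact ⟨hx, hS (fun a ha ↦ by_contra fun h' ↦ ha (h a h')) hσ⟩
    rw [this]
    refine (Set.toFinite S).isCompact_biUnion fun σ _ ↦ ?_
    have hcl : IsClosed {x : V × ZMod p → ℝ | ∀ a ∉ σ, x a = 0} := by
      simp only [Set.ofPred_forall]
      exact isClosed_iInter fun a ↦ isClosed_iInter fun _ ↦
        isClosed_eq (continuous_apply a) continuous_const
    exact (isCompact_stdSimplex ℝ _).inter_right hcl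
  obtain ⟨η, hη, hηX⟩ : ∃ η > 0, ∀ x ∈ X, ∃ k i j, Φ x (k, j) + η < Φ x (k, i) := by
    let U : ℕ → Set (V × ZMod p → ℝ) := fun n ↦
      ⋃ (k : κ) (i : ZMod p) (j : ZMod p), {x | Φ x (k, j) + 1 / ((n : ℝ) + 1) < Φ x (k, i)}
    have hU (n : ℕ) : IsOpen (U n) := isOpen_iUnion fun k ↦ isOpen_iUnion fun i ↦
      isOpen_iUnion fun j ↦ isOpen_lt (((continuous_apply _).comp hΦ).add continuous_const)
        ((continuous_apply _).comp hΦ)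
    have hmono : Monotone U := by
      intro n m hnm
      refine Set.iUnion_mono fun k ↦ Set.iUnion_mono fun i ↦ Set.iUnion_mono fun j x hx ↦ ?_
      have := Nat.one_div_le_one_div (α := ℝ) hnm
      simp only [Set.mem_ofPred_eq] at hx ⊢
      linarith
    have hcov : X ⊆ ⋃ n, U n := by
      intro x hx
      obtain ⟨k, i, j, hij⟩ := hcon x hx.1 hx.2
      obtain ⟨i, j, hij⟩ : ∃ i j, Φ x (k, j) < Φ x (k, i) := by
        rcases hij.lt_or_gt with h | h
        exacts [⟨j, i, h⟩, ⟨i, j, h⟩]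
      obtain ⟨n, hn⟩ := exists_nat_one_div_lt (sub_pos.2 hij)
      simp only [U, Set.mem_iUnion, Set.mem_ofPred_eq]
      exact ⟨n, k, i, j, by linarith⟩
    obtain ⟨n, hn⟩ := hX.elim_directed_cover U hU hcov hmono.directed_le
    refine ⟨1 / ((n : ℝ) + 1), by positivity, fun x hx ↦ ?_⟩
    simpa [U] using hn hx
  obtain ⟨δ, hδ, hδΦ⟩ := Metric.uniformContinuousOn_iff.1
    ((isCompact_stdSimplex ℝ (V × ZMod p)).uniformContinuousOn_of_continuous hΦ.continuousOn)
    (η / 2) (half_pos hη)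
  let lab : (V × ZMod p → ℝ) → Finset (κ × ZMod p) := fun x ↦
    Finset.univ.filter fun a ↦ ∃ j, Φ x (a.1, j) + η < Φ x a
  have hlab (x) (k) (i) : (k, i) ∈ lab x ↔ ∃ j, Φ x (k, j) + η < Φ x (k, i) := by simp [lab]
  let f : Finset (V × ZMod p → ℝ) →o Finset (κ × ZMod p) :=
    { toFun := fun T ↦ T.biUnion lab
      monotone' := fun _ _ h ↦ Finset.biUnion_subset_biUnion_of_subset_left _ h }
  have hf (T : Finset (V × ZMod p → ℝ)) (a : κ × ZMod p) : a ∈ f T ↔ ∃ x ∈ T, a ∈ lab x :=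
    Finset.mem_biUnion
  let g' : Finset (κ × ZMod p) ≃o Finset (κ × ZMod p) :=
    (shiftEquiv κ p).finsetCongr.toOrderIso (fun _ _ h ↦ Finset.map_subset_map.2 h)
      (fun _ _ h ↦ Finset.map_subset_map.2 h)
  have hg' (S : Finset (κ × ZMod p)) : g' S = S.map (shiftEquiv κ p).toEmbedding := rfl
  refine not_acyclic_of_map (ZMod p) (P := smallSets S δ) (D := deficientSets κ p)
    shiftImage (fun T hT ↦ shiftImage_mem_smallSets hSs hT) shiftImage_iterate g' ?_ rowMean
    (fun S hS ↦ rowMean_map_shiftEquiv hS) (fun l hl hD ↦ length_le_of_pairwise_gt l _ hl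
      fun S hS ↦ ⟨(hD S hS).1, card_le_of_mem_deficientSets (hD S hS)⟩) f ?_ ?_ (hac δ hδ)
  · rintro S ⟨⟨⟨k, i⟩, ha⟩, h⟩
    refine ⟨⟨(k, i + 1), ?_⟩, fun k ↦ ?_⟩
    · rw [hg', mem_map_shiftEquiv]
      simpa using ha
    · obtain ⟨i, hi⟩ := h k
      refine ⟨i + 1, ?_⟩
      rw [hg', mem_map_shiftEquiv]
      simpa using hi
  · intro T hT
    obtain ⟨x₀, hx₀⟩ := hT.1
    refine ⟨?_, fun k ↦ ?_⟩
    · have hsupp : {a | x₀ a ≠ 0} ⊆ coordSupport T := fun a ha ↦ ⟨x₀, hx₀, ha⟩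
      obtain ⟨k, i, j, h⟩ := hηX x₀ ⟨hT.2.1 x₀ hx₀, hS hsupp hT.2.2.2⟩
      exact ⟨(k, i), (hf _ _).2 ⟨x₀, hx₀, (hlab _ _ _).2 ⟨j, h⟩⟩⟩
    · by_contra! hall
      obtain ⟨i, -, hi⟩ := Finset.exists_min_image Finset.univ (fun i ↦ Φ x₀ (k, i))
        Finset.univ_nonempty
      obtain ⟨x, hx, hxi⟩ := (hf _ _).1 (hall i)
      obtain ⟨j, hj⟩ := (hlab _ _ _).1 hxi
      have hd := hδΦ x (hT.2.1 x hx) x₀ (hT.2.1 x₀ hx₀) (hT.2.2.1 x hx x₀ hx₀)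
      have h1 := (dist_le_pi_dist _ _ (k, i)).trans_lt hd
      have h2 := (dist_le_pi_dist _ _ (k, j)).trans_lt hd
      have h3 := hi j (Finset.mem_univ j)
      rw [Real.dist_eq, abs_lt] at h1 h2
      linarith [h1.2, h2.1]
  · intro T
    ext ⟨k, i⟩
    rw [hg', mem_map_shiftEquiv, hf, hf]
    constructor
    · rintro ⟨y, hy, hyl⟩
      obtain ⟨x, hx, rfl⟩ := mem_shiftImage.1 hy
      obtain ⟨j, hj⟩ := (hlab _ _ _).1 hyl
      exact ⟨x, hx, (hlab _ _ _).2 ⟨j - 1, hj⟩⟩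
    · rintro ⟨x, hx, hxl⟩
      obtain ⟨j, hj⟩ := (hlab _ _ _).1 hxl
      refine ⟨shift x, mem_shiftImage.2 ⟨x, hx, rfl⟩, (hlab _ _ _).2 ⟨j + 1, ?_⟩⟩
      simpa [Φ, shift] using hj

end Equivariant

section Extension

variable {V C : Type*} [Fintype V] [Fintype C]

/-- A partial proper colouring extends to all vertices if there are more colours than the maximal
degree. -/
lemma exists_extend_coloring (G : SimpleGraph V) [DecidableRel G.Adj]
    (hC : G.maxDegree < Fintype.card C) {σ : Set (V × C)}
    (hσ : σ ∈ listColorings G Finset.univ fun _ ↦ Finset.univ) :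
    ∃ c : V → C, (∀ v i, (v, i) ∈ σ → c v = i) ∧ ∀ u v, G.Adj u v → c u ≠ c v := by
  classical
  have key (W : Finset V) : ∃ τ ∈ listColorings G Finset.univ fun _ ↦ (Finset.univ : Finset C),
      σ ⊆ τ ∧ ∀ v ∈ W, ∃ i, (v, i) ∈ τ := by
    induction W using Finset.induction_on with
    | empty => exact ⟨σ, hσ, subset_rfl, by simp⟩
    | insert v W _ ih =>
      obtain ⟨τ, hτ, hστ, hW⟩ := ih
      obtain ⟨i, -, hi⟩ := exists_insert_mem_listColorings G (Finset.mem_univ v)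
        (by simpa using hC) hτ
      refine ⟨_, hi, hστ.trans (Set.subset_insert _ _), fun u hu ↦ ?_⟩
      rcases Finset.mem_insert.1 hu with rfl | hu
      · exact ⟨i, by simp⟩
      · exact (hW u hu).imp fun j hj ↦ Or.inr hj
  obtain ⟨τ, hτ, hστ, h⟩ := key Finset.univ
  choose c hc using fun v ↦ h v (Finset.mem_univ v)
  exact ⟨c, fun v i hvi ↦ hτ.2.1 v _ _ (hc v) (hστ hvi),
    fun u v huv heq ↦ hτ.2.2 u v (c u) (hc u) (heq ▸ hc v) huv⟩

end Extension

/-- The homogenization of a bounded continuous function on the affine hyperplane of coordinate sum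
one. -/
lemma continuous_homogenization {V : Type*} [Fintype V] {g : (V → ℝ) → ℝ} (hg : Continuous g)
    {B : ℝ} (hB : ∀ y, |g y| ≤ B) :
    Continuous fun y : V → ℝ ↦ (∑ v, y v) * g ((∑ v, y v)⁻¹ • y) := by
  rw [continuous_iff_continuousAt]
  intro y
  have hsum : Continuous fun y : V → ℝ ↦ ∑ v, y v := by fun_prop
  by_cases hy : ∑ v, y v = 0
  · have h0 : Filter.Tendsto (fun y : V → ℝ ↦ |∑ v, y v| * B) (𝓝 y) (𝓝 0) := by
      have : Continuous fun y : V → ℝ ↦ |∑ v, y v| * B := by fun_prop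
      simpa [hy] using this.tendsto y
    rw [ContinuousAt, hy, zero_mul]
    refine squeeze_zero_norm (fun z ↦ ?_) h0
    rw [norm_mul, Real.norm_eq_abs, Real.norm_eq_abs]
    exact mul_le_mul_of_nonneg_left (hB _) (abs_nonneg _)
  · exact hsum.continuousAt.mul (hg.continuousAt.comp
      ((hsum.continuousAt.inv₀ hy).smul continuousAt_id))

/-- A common value of `f` on disjoint faces that form a partial proper colouring with `p`
colours. -/
theorem exists_common_value {V : Type*} [Fintype V] [DecidableEq V] (G : SimpleGraph V)
    [DecidableRel G.Adj] {p d : ℕ} [Fact p.Prime]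
    (h : (p + G.maxDegree : ℤ) * ((d + 1) * (p - 1)) < (p - G.maxDegree) * Fintype.card V)
    {f : stdSimplex ℝ V → EuclideanSpace ℝ (Fin d)} (hf : Continuous f) :
    ∃ σ ∈ listColorings G Finset.univ fun _ ↦ (Finset.univ : Finset (ZMod p)),
      ∃ z : ZMod p → stdSimplex ℝ V, (∀ i v, (z i : V → ℝ) v ≠ 0 → (v, i) ∈ σ) ∧
        ∀ i j, f (z i) = f (z j) := by
  have hp : 0 < p := (Fact.out : p.Prime).pos
  have hext (k : Fin d) : ∃ g : (V → ℝ) → ℝ, Continuous g ∧ (∃ B, ∀ y, |g y| ≤ B) ∧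
      ∀ y : stdSimplex ℝ V, g y = f y k := by
    have : CompactSpace (stdSimplex ℝ V) :=
      isCompact_iff_compactSpace.1 (isCompact_stdSimplex ℝ V)
    have hfk : Continuous fun y ↦ f y k := by fun_prop
    obtain ⟨g, -, hg⟩ := (BoundedContinuousFunction.mkOfCompact
      ⟨_, hfk⟩).exists_extension_norm_eq_of_isClosedEmbedding
      (isClosed_stdSimplex ℝ V).isClosedEmbedding_subtypeVal
    exact ⟨g, g.continuous, ⟨‖g‖, fun y ↦ g.norm_coe_le_norm y⟩, fun y ↦ congrFun hg y⟩
  choose g hgc hgb hgf using hext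
  let φ : Fin (d + 1) → (V → ℝ) → ℝ := Fin.cons (fun y ↦ ∑ v, y v)
    fun k y ↦ (∑ v, y v) * g k ((∑ v, y v)⁻¹ • y)
  have hφ (k : Fin (d + 1)) : Continuous (φ k) := by
    refine Fin.cases ?_ (fun k ↦ ?_) k
    · simp only [φ, Fin.cons_zero]
      fun_prop
    · obtain ⟨B, hB⟩ := hgb k
      exact continuous_homogenization (hgc k) hB
  obtain ⟨x, hx, hσ, hxφ⟩ := exists_forall_eq_of_acyclic (p := p) (κ := Fin (d + 1))
    (S := listColorings G Finset.univ fun _ ↦ (Finset.univ : Finset (ZMod p)))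
    (isLowerSet_listColorings G _ _)
    (fun σ hσ ↦ ⟨by simp, fun v i j hi hj ↦ by simpa using hσ.2.1 v _ _ hi hj,
      fun u v i hu hv ↦ hσ.2.2 u v _ hu hv⟩)
    (fun δ hδ ↦ acyclic_listColorings G (ZMod p) hδ _ _ _ _ rfl (by
      have h1 : ((p - 1 : ℕ) : ℤ) = p - 1 := by omega
      simpa [ZMod.card, h1] using h)) hφ
  set y : ZMod p → V → ℝ := fun i v ↦ x (v, i) with hy
  have hsum (i j) : ∑ v, y i v = ∑ v, y j v := hxφ 0 i j
  have hone : ∑ i, ∑ v, y i v = 1 := by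
    rw [← hx.2, Fintype.sum_prod_type_right]
  have hpos (i) : ∑ v, y i v ≠ 0 := by
    intro h0
    rw [Finset.sum_eq_zero fun j _ ↦ (hsum j i).trans h0] at hone
    exact zero_ne_one hone
  have hnn (i) : 0 ≤ ∑ v, y i v := Finset.sum_nonneg fun v _ ↦ hx.1 (v, i)
  have hmem (i) : (∑ v, y i v)⁻¹ • y i ∈ stdSimplex ℝ V :=
    ⟨fun v ↦ mul_nonneg (inv_nonneg.2 (hnn i)) (hx.1 (v, i)), by
      simp only [Pi.smul_apply, smul_eq_mul, ← Finset.mul_sum]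
      exact inv_mul_cancel₀ (hpos i)⟩
  refine ⟨_, hσ, fun i ↦ ⟨_, hmem i⟩, fun i v hv ↦ ?_, fun i j ↦ ?_⟩
  · exact right_ne_zero_of_mul hv
  · ext k
    have hk : (∑ v, y i v) * g k ((∑ v, y i v)⁻¹ • y i)
        = (∑ v, y j v) * g k ((∑ v, y j v)⁻¹ • y j) := hxφ k.succ i j
    rw [← hgf, ← hgf]
    change g k ((∑ v, y i v)⁻¹ • y i) = g k ((∑ v, y j v)⁻¹ • y j)
    rw [hsum j i] at hk ⊢
    exact mul_left_cancel₀ (hpos i) hk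

end SmallSimplices

namespace ShortIntervals

open Complex ArithmeticFunction Filter Topology MeasureTheory

/-- Minus the logarithmic derivative of the zeta function minus the zeta function, continued to the
line `re s = 1`. -/
noncomputable def zetaGap (s : ℂ) : ℂ :=
  vonMangoldt.LFunctionResidueClassAux (1 : ZMod 1) s - riemannZeta₀ s

lemma continuousOn_zetaGap : ContinuousOn zetaGap {s | 1 ≤ s.re} :=
  (vonMangoldt.continuousOn_LFunctionResidueClassAux _).sub
    differentiable_riemannZeta₀.continuous.continuousOn

lemma continuous_zetaGap_max :
    Continuous fun z : ℝ × ℝ ↦ zetaGap (↑(max 1 z.1) + z.2 * I) :=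
  continuousOn_zetaGap.comp_continuous (by fun_prop) fun z ↦ by simp

lemma hasSum_zetaGap {s : ℂ} (hs : 1 < s.re) :
    LSeriesHasSum (fun n ↦ (Λ n : ℂ) - 1) s (zetaGap s) := by
  have hs1 : s ≠ 1 := fun h ↦ by simp [h] at hs
  have hΛ : (fun n ↦ (vonMangoldt.residueClass (1 : ZMod 1) n : ℂ)) = fun n ↦ (Λ n : ℂ) := by
    ext n
    exact congrArg _ (Set.indicator_of_mem (s := {n : ℕ | (n : ZMod 1) = 1})
      (Subsingleton.elim (n : ZMod 1) 1) _)
  have h := (LSeriesSummable_vonMangoldt hs).LSeriesHasSum.sub (LSeriesHasSum_one hs)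
  have heq : zetaGap s = LSeries (fun n ↦ (Λ n : ℂ)) s - riemannZeta s := by
    rw [zetaGap, vonMangoldt.eqOn_LFunctionResidueClassAux isUnit_one hs, hΛ,
      riemannZeta_eq_inv_sub_add hs1]
    simp [sub_sub]
  exact heq ▸ h

lemma hasSum_re_exp_mul_zetaGap {σ : ℝ} (hσ : 1 < σ) (t u : ℝ) :
    HasSum (fun n : ℕ ↦ (Λ n - 1) * (n : ℝ) ^ (-σ) * Real.cos (t * (u - Real.log n)))
      (exp (t * u * I) * zetaGap (σ + t * I)).re := by
  have h := hasSum_re ((hasSum_zetaGap (s := σ + t * I) (by simpa using hσ)).mul_left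
    (exp (t * u * I)))
  refine h.congr_fun fun n ↦ ?_
  rcases eq_or_ne n 0 with rfl | hn
  · simp [Real.zero_rpow (by linarith : -σ ≠ 0)]
  · have hn0 : (0 : ℝ) < n := by positivity
    rw [LSeries.term_of_ne_zero hn, div_eq_mul_inv, ← cpow_neg, cpow_def_of_ne_zero (by simpa),
      Real.rpow_def_of_pos hn0, ← natCast_log, mul_left_comm, ← Complex.exp_add]
    have : (t * u * I + Real.log n * -(σ + t * I) : ℂ)
        = ((Real.log n * -σ : ℝ) : ℂ) + ((t * (u - Real.log n) : ℝ) : ℂ) * I := by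
      push_cast; ring
    rw [this, Complex.exp_add, exp_mul_I, ← ofReal_exp, ← ofReal_cos, ← ofReal_sin,
      ← ofReal_one, ← ofReal_sub, re_ofReal_mul, re_ofReal_mul, add_re,
      re_ofReal_mul, I_re, ofReal_re, mul_zero, add_zero, mul_assoc]

/-- A Fejér kernel, as the transform of a triangular weight. -/
noncomputable def fejer (v : ℝ) : ℝ := ∫ t in (0 : ℝ)..1, (1 - t) * Real.cos (t * v)

lemma fejer_eq {v : ℝ} (hv : v ≠ 0) : fejer v = (1 - Real.cos v) / v ^ 2 := by
  have h (t : ℝ) (_ : t ∈ Set.uIcc 0 1) : HasDerivAt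
      (fun t ↦ (1 - t) * (Real.sin (t * v) / v) - Real.cos (t * v) / v ^ 2)
      ((1 - t) * Real.cos (t * v)) t := by
    have h1 : HasDerivAt (fun t ↦ t * v) v t := by simpa using (hasDerivAt_id t).mul_const v
    refine HasDerivAt.congr_deriv ((((hasDerivAt_id t).const_sub 1).mul (h1.sin.div_const v)).sub
      (h1.cos.div_const (v ^ 2))) ?_
    simp only [id]
    field_simp
    ring
  rw [fejer, intervalIntegral.integral_eq_sub_of_hasDerivAt h
    (Continuous.intervalIntegrable (by fun_prop) _ _)]
  simp
  ring

lemma fejer_nonneg (v : ℝ) : 0 ≤ fejer v := by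
  rcases eq_or_ne v 0 with rfl | hv
  · exact intervalIntegral.integral_nonneg zero_le_one fun t ht ↦ by simpa using ht.2
  · rw [fejer_eq hv]
    exact div_nonneg (sub_nonneg.2 (Real.cos_le_one v)) (sq_nonneg v)

lemma fejer_le {v : ℝ} (hv : v ≠ 0) : fejer v ≤ 2 / v ^ 2 := by
  rw [fejer_eq hv]
  gcongr
  linarith [Real.neg_one_le_cos v]

lemma integral_one_sub : ∫ t in (0 : ℝ)..1, (1 - t) = 1 / 2 := by
  rw [intervalIntegral.integral_sub (by simp) (by simp)]
  norm_num [integral_id]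

lemma fejer_le_half (v : ℝ) : fejer v ≤ 1 / 2 := by
  rw [← integral_one_sub]
  refine intervalIntegral.integral_mono_on zero_le_one
    (Continuous.intervalIntegrable (by fun_prop) _ _)
    (Continuous.intervalIntegrable (by fun_prop) _ _) fun t ht ↦ ?_
  exact mul_le_of_le_one_right (sub_nonneg.2 ht.2) (Real.cos_le_one _)

lemma le_fejer {v : ℝ} (hv : |v| ≤ 1) : Real.cos 1 / 2 ≤ fejer v := by
  have : Real.cos 1 / 2 = ∫ t in (0 : ℝ)..1, (1 - t) * Real.cos 1 := by
    rw [intervalIntegral.integral_mul_const, integral_one_sub]; ring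
  rw [this]
  refine intervalIntegral.integral_mono_on zero_le_one
    (Continuous.intervalIntegrable (by fun_prop) _ _)
    (Continuous.intervalIntegrable (by fun_prop) _ _) fun t ht ↦ ?_
  refine mul_le_mul_of_nonneg_left ?_ (sub_nonneg.2 ht.2)
  rw [← Real.cos_abs (t * v)]
  refine Real.cos_le_cos_of_nonneg_of_le_pi (abs_nonneg _) (by linarith [Real.pi_gt_three]) ?_
  rw [abs_mul, abs_of_nonneg ht.1]
  exact mul_le_one₀ ht.2 (abs_nonneg _) hv

/-- The transform of `zetaGap` against the triangular weight. -/
noncomputable def gapTransform (l u σ : ℝ) : ℂ :=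
  ∫ t in (0 : ℝ)..1, (1 - t) * exp (l * t * u * I) * zetaGap (↑(max 1 σ) + ↑(l * t) * I)

lemma continuous_gapTransform (l u : ℝ) : Continuous (gapTransform l u) := by
  refine intervalIntegral.continuous_parametric_intervalIntegral_of_continuous' ?_ _ _
  have : Continuous fun z : ℝ × ℝ ↦ zetaGap (↑(max 1 z.1) + ↑(l * z.2) * I) :=
    continuous_zetaGap_max.comp (f := fun z : ℝ × ℝ ↦ (z.1, l * z.2)) (by fun_prop)
  exact Continuous.mul (by fun_prop) this

lemma tendsto_gapTransform {l : ℝ} (hl : 0 < l) (σ : ℝ) :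
    Tendsto (fun u ↦ gapTransform l u σ) atTop (𝓝 0) := by
  have h := (Real.tendsto_integral_exp_smul_cocompact (Set.indicator (Set.Ioc (0 : ℝ) 1)
    fun t ↦ (1 - t : ℂ) * zetaGap (↑(max 1 σ) + ↑(l * t) * I))).comp
    ((tendsto_id.const_mul_atTop_of_neg (r := -(l / (2 * Real.pi)))
      (by simpa using by positivity)).mono_right atBot_le_cocompact)
  refine h.congr fun u ↦ ?_
  rw [gapTransform, intervalIntegral.integral_of_le zero_le_one,
    ← integral_indicator measurableSet_Ioc]
  refine integral_congr_ae (.of_forall fun t ↦ ?_)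
  by_cases ht : t ∈ Set.Ioc (0 : ℝ) 1
  · simp only [Set.indicator_of_mem ht, Circle.smul_def, Real.fourierChar_apply, smul_eq_mul, id]
    rw [← mul_assoc, mul_comm (exp _)]
    congr 3
    push_cast
    field_simp
  · simp [Set.indicator_of_notMem ht]

lemma hasSum_fejer {l σ : ℝ} (hσ : 1 < σ) (u : ℝ) :
    HasSum (fun n : ℕ ↦ (Λ n - 1) * (n : ℝ) ^ (-σ) * fejer (l * (u - Real.log n)))
      (gapTransform l u σ).re := by
  have hs : Summable fun n : ℕ ↦ |(Λ n - 1) * (n : ℝ) ^ (-σ)| := by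
    simpa using (hasSum_re_exp_mul_zetaGap hσ 0 0).summable.abs
  have h := intervalIntegral.hasSum_integral_of_dominated_convergence (μ := volume) (a := 0)
    (b := 1) (F := fun (n : ℕ) t ↦
      (1 - t) * ((Λ n - 1) * (n : ℝ) ^ (-σ) * Real.cos (l * t * (u - Real.log n))))
    (f := fun t ↦ (1 - t) * (exp (↑(l * t) * u * I) * zetaGap (σ + ↑(l * t) * I)).re)
    (fun n _ ↦ |(Λ n - 1) * (n : ℝ) ^ (-σ)|)
    (fun n ↦ Continuous.aestronglyMeasurable (by fun_prop))
    (fun n ↦ .of_forall fun t ht ↦ ?_) (.of_forall fun t ht ↦ hs)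
    (by simp) (.of_forall fun t ht ↦ (hasSum_re_exp_mul_zetaGap hσ (l * t) u).mul_left _)
  · have hc : Continuous fun t : ℝ ↦
        (1 - t : ℂ) * exp (l * t * u * I) * zetaGap (↑(max 1 σ) + ↑(l * t) * I) :=
      Continuous.mul (by fun_prop)
        (continuous_zetaGap_max.comp (f := fun t : ℝ ↦ (σ, l * t)) (by fun_prop))
    have hre : (gapTransform l u σ).re = ∫ t in (0 : ℝ)..1,
        (1 - t) * (exp (↑(l * t) * u * I) * zetaGap (σ + ↑(l * t) * I)).re := by
      rw [gapTransform, ← reCLM_apply, ← reCLM.intervalIntegral_comp_comm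
        (hc.intervalIntegrable _ _)]
      refine intervalIntegral.integral_congr fun t _ ↦ ?_
      simp only [reCLM_apply]
      rw [max_eq_right hσ.le, mul_assoc, ← ofReal_one, ← ofReal_sub, re_ofReal_mul, ofReal_mul]
    rw [hre]
    refine h.congr_fun fun n ↦ ?_
    rw [fejer, ← intervalIntegral.integral_const_mul]
    refine intervalIntegral.integral_congr fun t _ ↦ ?_
    ring_nf
  · rw [Set.uIoc_of_le zero_le_one] at ht
    rw [norm_mul, norm_mul, Real.norm_eq_abs, Real.norm_eq_abs, Real.norm_eq_abs, ← mul_assoc]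
    refine (mul_le_of_le_one_right (by positivity) (Real.abs_cos_le_one _)).trans
      (mul_le_of_le_one_left (abs_nonneg _) ?_)
    rw [abs_le]
    constructor <;> linarith [ht.1, ht.2]

lemma sum_vonMangoldt_div_le (T : Finset ℕ) {j : ℤ} (hT : ∀ n ∈ T, ⌊Real.log n⌋ = j) :
    ∑ n ∈ T, Λ n / n ≤ (Real.log 4 + 4) * Real.exp 1 := by
  have h1 (n : ℕ) (hn : n ∈ T) : Λ n / n ≤ Λ n * Real.exp (-j) := by
    rcases Nat.eq_zero_or_pos n with rfl | h0
    · simp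
    · have h0' : (0 : ℝ) < n := by exact_mod_cast h0
      rw [div_eq_mul_inv, Real.exp_neg]
      have : Real.exp j ≤ n := by
        rw [← Real.le_log_iff_exp_le h0', ← hT n hn]
        exact Int.floor_le _
      have := vonMangoldt_nonneg (n := n)
      gcongr
  have h2 : ∑ n ∈ T, Λ n ≤ Chebyshev.psi (Real.exp (j + 1)) := by
    rw [Chebyshev.psi_eq_sum_Icc]
    refine Finset.sum_le_sum_of_subset_of_nonneg (fun n hn ↦ ?_) fun n _ _ ↦ vonMangoldt_nonneg
    refine Finset.mem_Icc.2 ⟨n.zero_le, Nat.le_floor ?_⟩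
    rcases Nat.eq_zero_or_pos n with rfl | h0
    · simpa using (Real.exp_pos _).le
    · rw [← Real.log_le_iff_le_exp (by exact_mod_cast h0), ← hT n hn]
      exact (Int.lt_floor_add_one _).le
  calc ∑ n ∈ T, Λ n / n ≤ ∑ n ∈ T, Λ n * Real.exp (-j) := Finset.sum_le_sum h1
    _ = (∑ n ∈ T, Λ n) * Real.exp (-j) := (Finset.sum_mul ..).symm
    _ ≤ (Real.log 4 + 4) * Real.exp (j + 1) * Real.exp (-j) := by
        gcongr
        exact h2.trans (Chebyshev.psi_le_const_mul_self (Real.exp_pos _).le)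
    _ = (Real.log 4 + 4) * Real.exp 1 := by
        rw [mul_assoc, ← Real.exp_add]
        ring_nf

/-- A summable weight that controls the inverse square of the distance of real numbers by the
difference of their integral parts. -/
noncomputable def intWeight (m : ℤ) : ℝ := 1 / |(m : ℝ) + 1 / 2| ^ (2 : ℝ)

lemma intWeight_nonneg (m : ℤ) : 0 ≤ intWeight m := by
  unfold intWeight
  positivity

lemma summable_intWeight : Summable intWeight :=
  (Real.summable_one_div_int_add_rpow (1 / 2) 2).2 one_lt_two

lemma one_div_sq_sub_le {δ : ℝ} (hδ : 0 < δ) {u x : ℝ} (h : δ ≤ |u - x|) :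
    1 / (u - x) ^ 2 ≤ 8 * (1 + 1 / δ ^ 2) * intWeight (⌊x⌋ - ⌊u⌋) := by
  obtain ⟨m, hm⟩ : ∃ m, m = ⌊x⌋ - ⌊u⌋ := ⟨_, rfl⟩
  have hmr : (m : ℝ) = ⌊x⌋ - ⌊u⌋ := by rw [hm]; push_cast; rfl
  have a1 := Int.floor_le u
  have a2 := Int.lt_floor_add_one u
  have a3 := Int.floor_le x
  have a4 := Int.lt_floor_add_one x
  have b1 : m - 1 < x - u := by linarith
  have b2 : x - u < m + 1 := by linarith
  have hδ2 : δ ^ 2 ≤ (u - x) ^ 2 := by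
    rw [← sq_abs (u - _)]
    gcongr
  have hy : 0 < (u - x) ^ 2 := (by positivity : 0 < δ ^ 2).trans_le hδ2
  have hδ3 : 1 ≤ 1 / δ ^ 2 * (u - x) ^ 2 := by
    rw [one_div, inv_mul_eq_div, one_le_div (by positivity)]
    exact hδ2
  have hpos : 0 < ((m : ℝ) + 1 / 2) ^ 2 := by
    have : (m : ℝ) + 1 / 2 ≠ 0 := by
      intro h
      have : (2 * m + 1 : ℝ) = 0 := by linarith
      have : (2 * m + 1 : ℤ) = 0 := by exact_mod_cast this
      omega
    positivity
  rw [← hm, intWeight, Real.rpow_two, sq_abs, mul_one_div, div_le_div_iff₀ hy hpos, one_mul,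
    mul_assoc, add_mul, one_mul]
  rcases le_or_gt m (-2) with h2 | h2
  · have h2' : (m : ℝ) ≤ -2 := by exact_mod_cast h2
    have : (m + 1) ^ 2 ≤ (u - x) ^ 2 := by nlinarith
    nlinarith
  rcases le_or_gt 2 m with h3 | h3
  · have h3' : (2 : ℝ) ≤ m := by exact_mod_cast h3
    have : (m - 1) ^ 2 ≤ (u - x) ^ 2 := by nlinarith
    nlinarith
  · have h2' : (-1 : ℝ) ≤ m := by exact_mod_cast (by omega : -1 ≤ m)
    have h3' : (m : ℝ) ≤ 1 := by exact_mod_cast (by omega : m ≤ 1)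
    nlinarith

/-- The integers far from `exp u` contribute a bounded amount to the sum of `Λ n / n` with weight
`(u - log n)⁻²`. -/
lemma exists_sum_vonMangoldt_div_sq_le {δ : ℝ} (hδ : 0 < δ) :
    ∃ C > 0, ∀ (u : ℝ) (T : Finset ℕ), (∀ n ∈ T, δ ≤ |u - Real.log n|) →
      ∑ n ∈ T, Λ n / n / (u - Real.log n) ^ 2 ≤ C := by
  obtain ⟨M, hM⟩ : ∃ M, M = 8 * (1 + 1 / δ ^ 2) := ⟨_, rfl⟩
  obtain ⟨B, hB⟩ : ∃ B, B = (Real.log 4 + 4) * Real.exp 1 := ⟨_, rfl⟩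
  have hM0 : 0 ≤ M := by rw [hM]; positivity
  have hB0 : 0 ≤ B := by
    have : 0 ≤ Real.log 4 := Real.log_nonneg (by norm_num)
    rw [hB]; positivity
  have hS : 0 ≤ ∑' m, intWeight m := tsum_nonneg intWeight_nonneg
  refine ⟨M * B * ∑' m, intWeight m + 1, by positivity, fun u T hT ↦ ?_⟩
  obtain ⟨J, hJT⟩ : ∃ J : Finset ℤ, ∀ n ∈ T, ⌊Real.log n⌋ ∈ J :=
    ⟨T.image fun n : ℕ ↦ ⌊Real.log n⌋, fun n hn ↦ Finset.mem_image_of_mem _ hn⟩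
  have hJ : ∑ j ∈ J, intWeight (j - ⌊u⌋) ≤ ∑' m, intWeight m := by
    rw [← Finset.sum_image (f := intWeight) (g := fun j ↦ j - ⌊u⌋) (sub_left_injective.injOn)]
    exact summable_intWeight.sum_le_tsum _ fun m _ ↦ intWeight_nonneg m
  calc ∑ n ∈ T, Λ n / n / (u - Real.log n) ^ 2
      = ∑ j ∈ J, ∑ n ∈ T with ⌊Real.log (n : ℕ)⌋ = j, Λ n / n / (u - Real.log n) ^ 2 :=
        (Finset.sum_fiberwise_of_maps_to hJT _).symm
    _ ≤ ∑ j ∈ J, M * B * intWeight (j - ⌊u⌋) := by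
        refine Finset.sum_le_sum fun j _ ↦ ?_
        calc ∑ n ∈ T with ⌊Real.log (n : ℕ)⌋ = j, Λ n / n / (u - Real.log n) ^ 2
            ≤ ∑ n ∈ T with ⌊Real.log (n : ℕ)⌋ = j, Λ n / n * (M * intWeight (j - ⌊u⌋)) := by
              refine Finset.sum_le_sum fun n hn ↦ ?_
              rw [Finset.mem_filter] at hn
              rw [div_eq_mul_one_div (_ / _), ← hn.2, hM]
              exact mul_le_mul_of_nonneg_left (one_div_sq_sub_le hδ (hT n hn.1))
                (div_nonneg vonMangoldt_nonneg n.cast_nonneg)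
          _ ≤ B * (M * intWeight (j - ⌊u⌋)) := by
              rw [← Finset.sum_mul, hB]
              exact mul_le_mul_of_nonneg_right
                (sum_vonMangoldt_div_le _ fun n hn ↦ (Finset.mem_filter.1 hn).2)
                (mul_nonneg hM0 (intWeight_nonneg _))
          _ = M * B * intWeight (j - ⌊u⌋) := by ring
    _ = M * B * ∑ j ∈ J, intWeight (j - ⌊u⌋) := (Finset.mul_sum ..).symm
    _ ≤ M * B * ∑' m, intWeight m + 1 := by
        have := mul_le_mul_of_nonneg_left hJ (mul_nonneg hM0 hB0)
        linarith

lemma eventually_sum_not_prime_le {η : ℝ} (hη : 0 < η) :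
    ∃ N : ℕ, ∀ T : Finset ℕ, (∀ n ∈ T, N ≤ n ∧ ¬ n.Prime) → ∑ n ∈ T, Λ n / n ≤ η := by
  have hs := vonMangoldt.summable_residueClass_non_primes_div (1 : ZMod 1)
  obtain ⟨s, hs⟩ := summable_iff_vanishing_norm.1 hs η hη
  refine ⟨s.sup id + 1, fun T hT ↦ ?_⟩
  have h := hs T (Finset.disjoint_left.2 fun n hn hns ↦ by
    have := (hT n hn).1
    have := Finset.le_sup (f := id) hns
    simp only [id] at this
    omega)
  refine le_trans (le_of_eq (Finset.sum_congr rfl fun n hn ↦ ?_)) ((le_abs_self _).trans h.le)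
  rw [if_neg (hT n hn).2]
  congr 1
  exact (Set.indicator_of_mem (s := {n : ℕ | (n : ZMod 1) = 1})
      (Subsingleton.elim (n : ZMod 1) 1) _).symm

/-- The contribution of the integers in `(exp u, exp (u + 1 / l)]`. -/
lemma le_sum_fejer {l : ℝ} (hl : 1 ≤ l) (u : ℝ) :
    Real.cos 1 / 2 * (1 / (2 * l) - Real.exp (-u)) ≤
      ∑ n ∈ Finset.Ioc ⌊Real.exp u⌋₊ ⌊Real.exp (u + 1 / l)⌋₊,
        (n : ℝ) ^ (-1 : ℝ) * fejer (l * (u - Real.log n)) := by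
  set a := Real.exp u
  set b := Real.exp (u + 1 / l) with hb
  have ha : 0 < a := Real.exp_pos _
  have hb0 : 0 < b := Real.exp_pos _
  have hab : a ≤ b := Real.exp_le_exp.2 (by simp; positivity)
  have hcos := Real.cos_one_pos
  have hterm (n : ℕ) (hn : n ∈ Finset.Ioc ⌊a⌋₊ ⌊b⌋₊) :
      b⁻¹ * (Real.cos 1 / 2) ≤ (n : ℝ) ^ (-1 : ℝ) * fejer (l * (u - Real.log n)) := by
    obtain ⟨h1, h2⟩ := Finset.mem_Ioc.1 hn
    have h1 : a < n := (Nat.floor_lt ha.le).1 h1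
    have h2 : (n : ℝ) ≤ b := (Nat.le_floor_iff hb0.le).1 h2
    have hn0 : (0 : ℝ) < n := ha.trans h1
    rw [Real.rpow_neg_one]
    gcongr
    refine le_fejer ?_
    have h3 : u ≤ Real.log n := (Real.le_log_iff_exp_le hn0).2 h1.le
    have h4 : Real.log n ≤ u + 1 / l := (Real.log_le_iff_le_exp hn0).2 h2
    rw [abs_mul, abs_of_pos (by linarith), abs_of_nonpos (by linarith)]
    calc l * -(u - Real.log n) ≤ l * (1 / l) := by gcongr; linarith
      _ = 1 := by field_simp
  have hcard : b - a - 1 ≤ ((⌊b⌋₊ - ⌊a⌋₊ : ℕ) : ℝ) := by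
    rw [Nat.cast_sub (Nat.floor_mono hab)]
    linarith [Nat.floor_le ha.le, Nat.lt_floor_add_one b]
  have hba : 1 / (2 * l) - Real.exp (-u) ≤ (b - a - 1) * b⁻¹ := by
    have h1 : b * b⁻¹ = 1 := mul_inv_cancel₀ hb0.ne'
    have h2 : a * b⁻¹ = (Real.exp (1 / l))⁻¹ := by
      rw [hb, Real.exp_add, mul_inv, mul_inv_cancel_left₀ ha.ne']
    have h3 : b⁻¹ ≤ Real.exp (-u) := by
      rw [Real.exp_neg]
      gcongr
    have h4 : (Real.exp (1 / l))⁻¹ ≤ (1 + 1 / l)⁻¹ := by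
      gcongr
      linarith [Real.add_one_le_exp (1 / l)]
    have h5 : 1 / (2 * l) ≤ 1 - (1 + 1 / l)⁻¹ := by
      have : 1 - (1 + 1 / l)⁻¹ = 1 / (l + 1) := by field_simp; ring
      rw [this]
      gcongr
      linarith
    linarith
  calc Real.cos 1 / 2 * (1 / (2 * l) - Real.exp (-u))
      ≤ Real.cos 1 / 2 * (((⌊b⌋₊ - ⌊a⌋₊ : ℕ) : ℝ) * b⁻¹) := by
        gcongr
        exact hba.trans (by gcongr)
    _ = ∑ n ∈ Finset.Ioc ⌊a⌋₊ ⌊b⌋₊, b⁻¹ * (Real.cos 1 / 2) := by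
        rw [Finset.sum_const, Nat.card_Ioc, nsmul_eq_mul]
        ring
    _ ≤ _ := Finset.sum_le_sum hterm

lemma sum_vonMangoldt_mul_fejer_le {δ C η l σ u : ℝ} {N : ℕ} (hl : 0 < l) (hσ : 1 < σ)
    (hC : ∀ T : Finset ℕ, (∀ n ∈ T, δ ≤ |u - Real.log n|) →
      ∑ n ∈ T, Λ n / n / (u - Real.log n) ^ 2 ≤ C)
    (hη : ∀ T : Finset ℕ, (∀ n ∈ T, N ≤ n ∧ ¬ n.Prime) → ∑ n ∈ T, Λ n / n ≤ η)
    (hδ : 0 < δ) (hu : δ ≤ u) (hN : N ≤ Real.exp (u - δ))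
    (hp : ∀ p : ℕ, p.Prime → δ ≤ |u - Real.log p|) (T : Finset ℕ) :
    ∑ n ∈ T, Λ n * (n : ℝ) ^ (-σ) * fejer (l * (u - Real.log n)) ≤ η + C * (2 / l ^ 2) := by
  have hle (n : ℕ) : Λ n * (n : ℝ) ^ (-σ) ≤ Λ n / n := by
    rcases Nat.eq_zero_or_pos n with rfl | h0
    · simp
    · rw [div_eq_mul_inv, ← Real.rpow_neg_one]
      have : (1 : ℝ) ≤ n := by exact_mod_cast h0
      exact mul_le_mul_of_nonneg_left (Real.rpow_le_rpow_of_exponent_le this (by linarith))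
        vonMangoldt_nonneg
  have hnn (n : ℕ) : 0 ≤ Λ n / n := div_nonneg vonMangoldt_nonneg n.cast_nonneg
  rw [← Finset.sum_filter_add_sum_filter_not T (fun n : ℕ ↦ |u - Real.log n| < δ)]
  refine add_le_add ((Finset.sum_le_sum fun n _ ↦ ?_).trans (hη _ fun n hn ↦ ?_))
    ((Finset.sum_le_sum (g := fun n : ℕ ↦ Λ n / n / (u - Real.log n) ^ 2 * (2 / l ^ 2))
      fun n hn ↦ ?_).trans ?_)
  · exact (mul_le_mul_of_nonneg_right (hle n) (fejer_nonneg _)).trans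
      (mul_le_of_le_one_right (hnn n) ((fejer_le_half _).trans (by norm_num)))
  · have h := (Finset.mem_filter.1 hn).2
    refine ⟨?_, fun hn' ↦ (hp n hn').not_gt h⟩
    have h1 := (abs_lt.1 h).2
    rcases Nat.eq_zero_or_pos n with rfl | h0
    · simp at h1
      linarith
    · have : Real.exp (u - δ) ≤ n :=
        (Real.le_log_iff_exp_le (by exact_mod_cast h0)).1 (by linarith)
      exact_mod_cast hN.trans this
  · have h := not_lt.1 (Finset.mem_filter.1 hn).2
    have h0 : u - Real.log n ≠ 0 := abs_pos.1 (hδ.trans_le h)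
    refine (mul_le_mul (hle n) (fejer_le (mul_ne_zero hl.ne' h0)) (fejer_nonneg _)
      (hnn n)).trans (le_of_eq ?_)
    rw [mul_pow]
    field_simp
  · rw [← Finset.sum_mul]
    exact mul_le_mul_of_nonneg_right
      (hC _ fun n hn ↦ not_lt.1 (Finset.mem_filter.1 hn).2) (by positivity)

/-- Primes in short intervals, on a logarithmic scale. -/
theorem eventually_exists_prime_abs_sub_log_lt {δ : ℝ} (hδ : 0 < δ) :
    ∀ᶠ u : ℝ in atTop, ∃ p : ℕ, p.Prime ∧ |u - Real.log p| < δ := by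
  obtain ⟨C, hC0, hC⟩ := exists_sum_vonMangoldt_div_sq_le hδ
  set κ : ℝ := Real.cos 1 / 2 with hκ
  have hκ0 : 0 < κ := half_pos Real.cos_one_pos
  set l : ℝ := max 1 (16 * C / κ)
  have hl1 : 1 ≤ l := le_max_left _ _
  have hl0 : 0 < l := zero_lt_one.trans_le hl1
  have hCl : C * (2 / l ^ 2) ≤ κ / l / 8 := by
    have : 16 * C ≤ l * κ := (div_le_iff₀ hκ0).1 (le_max_right _ _)
    calc C * (2 / l ^ 2) = 16 * C / (8 * l ^ 2) := by ring
      _ ≤ l * κ / (8 * l ^ 2) := by gcongr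
      _ = κ / l / 8 := by field_simp
  have hη : 0 < κ / l / 16 := by positivity
  obtain ⟨N, hN⟩ := eventually_sum_not_prime_le hη
  have hgap := (tendsto_gapTransform hl0 1).norm.eventually_le_const (u := κ / l / 16)
    (by simpa using hη)
  have hexp := (Real.tendsto_exp_neg_atTop_nhds_zero).eventually_le_const
    (u := 1 / l / 16) (by positivity)
  have hNu : ∀ᶠ u in atTop, (N : ℝ) ≤ Real.exp (u - δ) :=
    (Real.tendsto_exp_atTop.comp
      (tendsto_atTop_add_const_right _ (-δ) tendsto_id)).eventually_ge_atTop _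
  filter_upwards [hgap, hexp, hNu, eventually_ge_atTop δ] with u h1 h2 h3 h4
  by_contra! hp
  set J := Finset.Ioc ⌊Real.exp u⌋₊ ⌊Real.exp (u + 1 / l)⌋₊
  have key (σ : ℝ) (hσ : 1 < σ) :
      ∑ n ∈ J, (n : ℝ) ^ (-σ) * fejer (l * (u - Real.log n)) ≤
        κ / l / 16 + C * (2 / l ^ 2) - (gapTransform l u σ).re := by
    have h : Tendsto (fun T : Finset ℕ ↦
        ∑ n ∈ T, (Λ n - 1) * (n : ℝ) ^ (-σ) * fejer (l * (u - Real.log n))) atTop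
        (𝓝 (gapTransform l u σ).re) := hasSum_fejer hσ u
    rw [le_sub_comm]
    refine le_of_tendsto h ((eventually_ge_atTop J).mono fun T hT ↦ ?_)
    have hT1 := sum_vonMangoldt_mul_fejer_le hl0 hσ (hC u) hN hδ h4 h3 hp T
    have hT2 := Finset.sum_le_sum_of_subset_of_nonneg (f := fun n : ℕ ↦
      (n : ℝ) ^ (-σ) * fejer (l * (u - Real.log n))) hT
      fun n _ _ ↦ mul_nonneg (by positivity) (fejer_nonneg _)
    simp only [sub_mul, one_mul, Finset.sum_sub_distrib]
    linarith
  have hlim : ∑ n ∈ J, (n : ℝ) ^ (-1 : ℝ) * fejer (l * (u - Real.log n)) ≤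
      κ / l / 16 + C * (2 / l ^ 2) - (gapTransform l u 1).re := by
    have hl : Continuous fun σ : ℝ ↦
        ∑ n ∈ J, (n : ℝ) ^ (-σ) * fejer (l * (u - Real.log n)) := by
      refine continuous_finsetSum _ fun n hn ↦ Continuous.mul ?_ continuous_const
      have : (n : ℝ) ≠ 0 := by
        exact_mod_cast ((Nat.zero_le _).trans_lt (Finset.mem_Ioc.1 hn).1).ne'
      exact (Real.continuous_const_rpow this).comp continuous_neg
    have hr : Continuous fun σ : ℝ ↦
        κ / l / 16 + C * (2 / l ^ 2) - (gapTransform l u σ).re :=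
      continuous_const.sub (Complex.continuous_re.comp (continuous_gapTransform l u))
    exact le_of_tendsto_of_tendsto ((hl.tendsto 1).mono_left nhdsWithin_le_nhds)
      ((hr.tendsto 1).mono_left nhdsWithin_le_nhds)
      (eventually_mem_nhdsWithin.mono fun σ (hσ : σ ∈ Set.Ioi 1) ↦ key σ hσ)
  have hlow := (le_sum_fejer hl1 u).trans hlim
  have hre := (abs_le.1 (Complex.abs_re_le_norm (gapTransform l u 1))).1
  have h5 : κ * Real.exp (-u) ≤ κ / l / 16 := by
    calc κ * Real.exp (-u) ≤ κ * (1 / l / 16) := by gcongr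
      _ = κ / l / 16 := by ring
  have h6 : κ * (1 / (2 * l) - Real.exp (-u)) = κ / l / 2 - κ * Real.exp (-u) := by
    field_simp
  rw [h6] at hlow
  linarith

/-- Primes in short intervals: for large `n` there is a prime between `n` and `(1 + ε) n`. -/
theorem exists_prime_between {ε : ℝ} (hε : 0 < ε) :
    ∃ n₀ : ℕ, ∀ n ≥ n₀, ∃ p : ℕ, p.Prime ∧ n ≤ p ∧ (p : ℝ) ≤ (1 + ε) * n := by
  have hδ : 0 < Real.log (1 + ε) / 2 := half_pos (Real.log_pos (by linarith))
  have hu : Tendsto (fun n : ℕ ↦ Real.log n + Real.log (1 + ε) / 2) atTop atTop :=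
    tendsto_atTop_add_const_right _ _ (Real.tendsto_log_atTop.comp tendsto_natCast_atTop_atTop)
  obtain ⟨n₀, hn₀⟩ := eventually_atTop.1
    ((hu.eventually (eventually_exists_prime_abs_sub_log_lt hδ)).and (eventually_gt_atTop 0))
  refine ⟨n₀, fun n hn ↦ ?_⟩
  obtain ⟨⟨p, hp, hlt⟩, hn0⟩ := hn₀ n hn
  have hn0 : (0 : ℝ) < n := by exact_mod_cast hn0
  have hp0 : (0 : ℝ) < p := by exact_mod_cast hp.pos
  obtain ⟨h1, h2⟩ := abs_lt.1 hlt
  refine ⟨p, hp, ?_, ?_⟩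
  · exact_mod_cast (Real.log_le_log_iff hn0 hp0).1 (by linarith)
  · rw [← Real.log_le_log_iff hp0 (by positivity), Real.log_mul (by positivity) hn0.ne']
    linarith

end ShortIntervals

/-- For every `ε > 0` there are a constant `K > 0` and thresholds `d₀, Δ₀` such that:
for every `d ≥ d₀` and `q`, every graph `G` on `⌈((d+1)(q-1)+1)(1+ε)⌉` vertices with
maximal degree `Δ ≥ Δ₀` satisfying `q > K·Δ`, and every continuous map `f` from the
geometric simplex on the vertex set of `G` to `ℝ^d`, there is a proper `q`-coloring of `G`
whose monochromatic faces have images under `f` with a common point. -/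
theorem tverberg_fixed_parameter (ε : ℝ) (hε : 0 < ε) :
    ∃ K : ℝ, 0 < K ∧ ∃ d₀ Δ₀ : ℕ, ∀ d : ℕ, d₀ ≤ d → ∀ q : ℕ,
      ∀ (V : Type) [Fintype V] [DecidableEq V] (G : SimpleGraph V) [DecidableRel G.Adj],
        Fintype.card V = ⌈(((d + 1) * (q - 1) + 1 : ℕ) : ℝ) * (1 + ε)⌉₊ →
        Δ₀ ≤ G.maxDegree → K * (G.maxDegree : ℝ) < (q : ℝ) →
        ∀ f : stdSimplex ℝ V → EuclideanSpace ℝ (Fin d), Continuous f →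
          ∃ C : Fin q → Finset V,
            (∀ v : V, ∃! i : Fin q, v ∈ C i) ∧
            (∀ i : Fin q, ∀ u ∈ C i, ∀ w ∈ C i, ¬ G.Adj u w) ∧
            (⋂ i : Fin q,
              f '' {x : stdSimplex ℝ V | ∀ v ∉ C i, (x : V → ℝ) v = 0}).Nonempty := by
  obtain ⟨n₀, hn₀⟩ := ShortIntervals.exists_prime_between (ε := ε / 4) (by positivity)
  refine ⟨4 / ε + 3, by positivity, 0, n₀ + 1, fun d _ q V _ _ G _ hV hΔ hq f hf ↦ ?_⟩
  set K : ℝ := 4 / ε + 3 with hK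
  have hKε : K * ε = 4 + 3 * ε := by rw [hK]; field_simp
  have hK3 : 3 ≤ K := by rw [hK]; linarith [div_pos four_pos hε]
  have hΔ1 : (n₀ : ℝ) + 1 ≤ G.maxDegree := by exact_mod_cast hΔ
  have hΔq : (3 : ℝ) * G.maxDegree < q :=
    lt_of_le_of_lt (mul_le_mul_of_nonneg_right hK3 (Nat.cast_nonneg _)) hq
  have hΔq' : 3 * G.maxDegree < q := by exact_mod_cast hΔq
  obtain ⟨p, hp, hqp, hpq⟩ := hn₀ q (by omega)
  have : Fact p.Prime := ⟨hp⟩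
  have hcard : (((d + 1) * (q - 1) + 1 : ℝ)) * (1 + ε) ≤ Fintype.card V := by
    have h1 : ((q - 1 : ℕ) : ℝ) = q - 1 := by rw [Nat.cast_sub (by omega)]; simp
    rw [hV]
    refine le_trans (le_of_eq ?_) (Nat.le_ceil _)
    push_cast
    rw [h1]
  have hineq : ((p : ℝ) + G.maxDegree) * ((d + 1) * (p - 1))
      < (p - G.maxDegree) * Fintype.card V := by
    have hqp' : (q : ℝ) ≤ p := by exact_mod_cast hqp
    have hq2 : (2 : ℝ) ≤ q := by exact_mod_cast (by omega : 2 ≤ q)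
    set Δ : ℝ := (G.maxDegree : ℝ)
    have hd : (0 : ℝ) < d + 1 := by positivity
    have h1 : (p : ℝ) - 1 ≤ (1 + ε / 2) * (q - 1) := by nlinarith
    have h2 : K * (p + Δ) ≤ (K + 1) * p := by nlinarith
    have h3 : (K - 1) * p ≤ K * (p - Δ) := by nlinarith
    have h4 : (K + 1) * (1 + ε / 2) = (K - 1) * (1 + ε) := by linarith
    have h5 : K * ((p + Δ) * ((d + 1) * (p - 1))) < K * ((p - Δ) * Fintype.card V) := by
      calc K * ((p + Δ) * ((d + 1) * (p - 1))) = K * (p + Δ) * ((d + 1) * (p - 1)) := by ring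
        _ ≤ (K + 1) * p * ((d + 1) * ((1 + ε / 2) * (q - 1))) := by
            gcongr
            exact mul_nonneg hd.le (by linarith)
        _ = (K + 1) * (1 + ε / 2) * (p * ((d + 1) * (q - 1))) := by ring
        _ = (K - 1) * p * ((d + 1) * (q - 1) * (1 + ε)) := by rw [h4]; ring
        _ < (K - 1) * p * (((d + 1) * (q - 1) + 1) * (1 + ε)) := by
            have : 0 < (K - 1) * (p : ℝ) := mul_pos (by linarith) (by linarith)
            gcongr
            linarith
        _ ≤ K * (p - Δ) * Fintype.card V := by
            refine mul_le_mul h3 hcard (mul_nonneg ?_ (by linarith)) (by nlinarith)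
            nlinarith
        _ = K * ((p - Δ) * Fintype.card V) := by ring
    exact lt_of_mul_lt_mul_left h5 (by linarith)
  obtain ⟨σ, hσ, z, hz, hfz⟩ := SmallSimplices.exists_common_value G (p := p) (d := d)
    (by exact_mod_cast hineq) hf
  obtain ⟨e⟩ : Nonempty (Fin q ↪ ZMod p) := by
    rw [Function.Embedding.nonempty_iff_card_le]
    simpa [ZMod.card] using hqp
  obtain ⟨c, hc, hcG⟩ := SmallSimplices.exists_extend_coloring G (C := Fin q)
    (σ := {a | (a.1, e a.2) ∈ σ}) (by rw [Fintype.card_fin]; omega)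
    ⟨by simp, fun v i j hi hj ↦ e.injective (hσ.2.1 v _ _ hi hj),
      fun u v i hu hv ↦ hσ.2.2 u v _ hu hv⟩
  refine ⟨fun i ↦ Finset.univ.filter (c · = i), fun v ↦ ⟨c v, by simp, by simp +contextual⟩, ?_,
    f (z (e ⟨0, by omega⟩)), ?_⟩
  · intro i u hu w hw hadj
    simp only [Finset.mem_filter] at hu hw
    exact hcG u w hadj (hu.2.trans hw.2.symm)
  · refine Set.mem_iInter.2 fun i ↦ ⟨z (e i), fun v hv ↦ ?_, hfz _ _⟩
    by_contra hne
    exact hv (by simpa using hc v i (hz _ _ hne))
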